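/- arXiv:1602.07313 — 3 statements merged into one kernel-verified Lean document; each statement's English description precedes it below -/
import Mathlib

section
/- For every q ∈ ℕ₀ there is a constant c > 0 depending only on q such that for every n ∈ ℕ and every q-monotone function f ∈ C[0,1], the degree of best q-monotone polynomial approximation satisfies E_n^{(q)}(f) ≤ c ω₂^φ(f, 1/n). -/
noncomputable section

open Set Finset
open scoped Classical

/-- The interval `[0,1]`. -/
def I01 : Set ℝ := Set.Icc 0 1

/-- `φ(x) = √(x(1-x))`. -/
def phi (x : ℝ) : ℝ := Real.sqrt (x * (1 - x))

/-- The `k`-th symmetric difference of `f` with step `δ`. -/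
def centralDiff (k : ℕ) (δ : ℝ) (f : ℝ → ℝ) (x : ℝ) : ℝ :=
  if (x - k * δ / 2) ∈ I01 ∧ (x + k * δ / 2) ∈ I01 then
    ∑ i ∈ Finset.range (k + 1),
      (k.choose i : ℝ) * (-1 : ℝ) ^ (k - i) * f (x - k * δ / 2 + i * δ)
  else 0

/-- The second Ditzian–Totik modulus of smoothness with step-weight `ψ`. -/
def omega2 (ψ : ℝ → ℝ) (f : ℝ → ℝ) (t : ℝ) : ℝ :=
  sSup {v : ℝ | ∃ s x : ℝ, 0 < s ∧ s ≤ t ∧ x ∈ I01 ∧ v = |centralDiff 2 (s * ψ x) f x|}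

/-- `f` is `k`-monotone on `[0,1]`. -/
def kMono (k : ℕ) (f : ℝ → ℝ) : Prop :=
  ∀ δ : ℝ, 0 < δ → ∀ x ∈ I01, 0 ≤ centralDiff k δ f x

/-- `g` coincides (on all of `ℝ`) with an algebraic polynomial of degree at most `n`. -/
def IsPolyOfDegLe (n : ℕ) (g : ℝ → ℝ) : Prop :=
  ∃ p : Polynomial ℝ, p.natDegree ≤ n ∧ ∀ x, g x = p.eval x

/-- `L` is a positive linear operator `C[0,1] → C[0,1]`. -/
def PositiveLinearOp (L : (ℝ → ℝ) → (ℝ → ℝ)) : Prop :=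
  (∀ f g : ℝ → ℝ, ContinuousOn f I01 → ContinuousOn g I01 →
      ∀ x ∈ I01, L (fun y => f y + g y) x = L f x + L g x) ∧
  (∀ (a : ℝ) (f : ℝ → ℝ), ContinuousOn f I01 →
      ∀ x ∈ I01, L (fun y => a * f y) x = a * L f x) ∧
  (∀ f : ℝ → ℝ, ContinuousOn f I01 → ContinuousOn (L f) I01) ∧
  (∀ f : ℝ → ℝ, ContinuousOn f I01 → (∀ x ∈ I01, 0 ≤ f x) → ∀ x ∈ I01, 0 ≤ L f x)

/-- The sup-norm over `[0,1]`. -/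
def supNormI (f : ℝ → ℝ) : ℝ := sSup {v : ℝ | ∃ x ∈ I01, v = |f x|}

/-- `E_n^{(q)}(f)`: the degree of best uniform `q`-monotone polynomial approximation of `f`. -/
def bestQMonoApprox (q n : ℕ) (f : ℝ → ℝ) : ℝ :=
  sInf {v : ℝ | ∃ p : Polynomial ℝ, p.natDegree ≤ n ∧
    kMono q (fun x => p.eval x) ∧ v = supNormI (fun x => f x - p.eval x)}

namespace QMono

open Polynomial

/-! ### Integration of polynomials and Bernstein polynomials -/

/-- The integral of a polynomial over `[0,1]`, as a linear functional. -/
def integ : ℝ[X] →ₗ[ℝ] ℝ where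
  toFun f := ∫ t in (0 : ℝ)..1, f.eval t
  map_add' f g := by
    simp only [eval_add]
    exact intervalIntegral.integral_add (f.continuous.intervalIntegrable _ _)
      (g.continuous.intervalIntegrable _ _)
  map_smul' c f := by
    simp [intervalIntegral.integral_const_mul]

theorem integ_apply (f : ℝ[X]) : integ f = ∫ t in (0 : ℝ)..1, f.eval t := rfl

theorem integ_derivative (f : ℝ[X]) : integ (derivative f) = f.eval 1 - f.eval 0 :=
  intervalIntegral.integral_eq_sub_of_hasDerivAt (fun x _ => f.hasDerivAt x)
    ((derivative f).continuous.intervalIntegrable _ _)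

theorem integ_mul_derivative (f g : ℝ[X]) :
    integ (f * derivative g) =
      f.eval 1 * g.eval 1 - f.eval 0 * g.eval 0 - integ (derivative f * g) := by
  have h := integ_derivative (f * g)
  rw [derivative_mul, map_add, eval_mul, eval_mul] at h
  linarith

theorem integ_mono {f g : ℝ[X]} (h : ∀ t ∈ Icc (0 : ℝ) 1, f.eval t ≤ g.eval t) :
    integ f ≤ integ g :=
  intervalIntegral.integral_mono_on zero_le_one (f.continuous.intervalIntegrable _ _)
    (g.continuous.intervalIntegrable _ _) h

theorem integ_nonneg {f : ℝ[X]} (h : ∀ t ∈ Icc (0 : ℝ) 1, 0 ≤ f.eval t) : 0 ≤ integ f := by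
  simpa using integ_mono (f := 0) (g := f) (by simpa using h)

theorem bernstein_eval (n k : ℕ) (x : ℝ) :
    (bernsteinPolynomial ℝ n k).eval x = n.choose k * x ^ k * (1 - x) ^ (n - k) := by
  simp [bernsteinPolynomial]

theorem bernstein_eval_nonneg (n k : ℕ) {x : ℝ} (hx : x ∈ Icc (0 : ℝ) 1) :
    0 ≤ (bernsteinPolynomial ℝ n k).eval x := by
  rw [bernstein_eval]
  have := sub_nonneg.2 hx.2
  have := hx.1
  positivity

theorem derivative_bernstein_succ (n k : ℕ) :
    derivative (bernsteinPolynomial ℝ (n + 1) (k + 1)) =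
      ((n : ℝ) + 1) • (bernsteinPolynomial ℝ n k - bernsteinPolynomial ℝ n (k + 1)) := by
  rw [bernsteinPolynomial.derivative_succ, smul_eq_C_mul]
  simp

theorem derivative_bernstein_zero (n : ℕ) :
    derivative (bernsteinPolynomial ℝ (n + 1) 0) =
      -(((n : ℝ) + 1) • bernsteinPolynomial ℝ n 0) := by
  rw [bernsteinPolynomial.derivative_zero, smul_eq_C_mul]
  simp
  ring

theorem integ_bernstein (n k : ℕ) (hk : k ≤ n) :
    integ (bernsteinPolynomial ℝ n k) = 1 / (n + 1) := by
  have hn : (n : ℝ) + 1 ≠ 0 := by positivity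
  induction k with
  | zero =>
    have h := integ_derivative (bernsteinPolynomial ℝ (n + 1) 0)
    rw [derivative_bernstein_zero, map_neg, map_smul, bernsteinPolynomial.eval_at_0,
      bernsteinPolynomial.eval_at_1] at h
    simp at h
    field_simp
    linarith
  | succ k ih =>
    have h := integ_derivative (bernsteinPolynomial ℝ (n + 1) (k + 1))
    rw [derivative_bernstein_succ, map_smul, map_sub, ih (by omega),
      bernsteinPolynomial.eval_at_0, bernsteinPolynomial.eval_at_1,
      if_neg (by omega), if_neg (by omega)] at h
    have := (mul_eq_zero.1 (h.trans (sub_self _))).resolve_left hn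
    linarith

theorem derivative_sum_bernstein (n : ℕ) (c : ℕ → ℝ) :
    derivative (∑ k ∈ Finset.range (n + 2), c k • bernsteinPolynomial ℝ (n + 1) k) =
      ((n : ℝ) + 1) •
        ∑ j ∈ Finset.range (n + 1), (c (j + 1) - c j) • bernsteinPolynomial ℝ n j := by
  rw [Finset.sum_range_succ', derivative_add, derivative_sum]
  simp only [derivative_smul, derivative_bernstein_succ, derivative_bernstein_zero]
  have h1 : ∑ j ∈ Finset.range (n + 1), c j • bernsteinPolynomial ℝ n j =
      (∑ j ∈ Finset.range (n + 1), c (j + 1) • bernsteinPolynomial ℝ n (j + 1)) +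
        c 0 • bernsteinPolynomial ℝ n 0 := by
    rw [← Finset.sum_range_succ' (fun j => c j • bernsteinPolynomial ℝ n j),
      Finset.sum_range_succ _ (n + 1), bernsteinPolynomial.eq_zero_of_lt _ (Nat.lt_succ_self n)]
    simp
  simp only [sub_smul, Finset.sum_sub_distrib, smul_sub, smul_comm (c _) ((n : ℝ) + 1)]
  rw [h1, smul_add, ← Finset.smul_sum, ← Finset.smul_sum, smul_neg,
    smul_comm (c 0) ((n : ℝ) + 1)]
  abel

/-! ### The genuine Bernstein-Durrmeyer operators -/

/-- The `k`-th Bernstein coefficient of `durr n f`. -/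
def durrCoef (n k : ℕ) : ℝ[X] →ₗ[ℝ] ℝ where
  toFun f := f.eval 0 + ∑ j ∈ Finset.range k, integ (bernsteinPolynomial ℝ n j * derivative f)
  map_add' f g := by
    simp only [eval_add, mul_add, map_add, Finset.sum_add_distrib]
    ring
  map_smul' c f := by
    simp [Finset.mul_sum, mul_add]

theorem durrCoef_apply (n k : ℕ) (f : ℝ[X]) : durrCoef n k f =
    f.eval 0 + ∑ j ∈ Finset.range k, integ (bernsteinPolynomial ℝ n j * derivative f) := rfl

/-- The genuine Bernstein-Durrmeyer operator of degree `n + 1`. -/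
def durr (n : ℕ) : ℝ[X] →ₗ[ℝ] ℝ[X] :=
  ∑ k ∈ Finset.range (n + 2), (durrCoef n k).smulRight (bernsteinPolynomial ℝ (n + 1) k)

theorem durr_apply (n : ℕ) (f : ℝ[X]) : durr n f =
    ∑ k ∈ Finset.range (n + 2), durrCoef n k f • bernsteinPolynomial ℝ (n + 1) k := by
  simp [durr, LinearMap.sum_apply]

theorem natDegree_bernstein_le (n k : ℕ) : (bernsteinPolynomial ℝ n k).natDegree ≤ n := by
  rcases lt_or_ge n k with h | h
  · simp [bernsteinPolynomial.eq_zero_of_lt _ h]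
  · unfold bernsteinPolynomial
    have h1 : ((1 : ℝ[X]) - X).natDegree ≤ 1 := by compute_degree
    have : ((n.choose k : ℝ[X]) * X ^ k * (1 - X) ^ (n - k)).natDegree ≤ (0 + k) + (n - k) := by
      refine natDegree_mul_le_of_le (natDegree_mul_le_of_le ?_ ?_) ?_
      · simp
      · simp
      · simpa using natDegree_pow_le_of_le (n - k) h1
    omega

theorem natDegree_durr_le (n : ℕ) (f : ℝ[X]) : (durr n f).natDegree ≤ n + 1 := by
  rw [durr_apply]
  refine natDegree_sum_le_of_forall_le _ _ fun k _ => ?_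
  exact (natDegree_smul_le _ _).trans (natDegree_bernstein_le _ _)

theorem derivative_durr (n : ℕ) (f : ℝ[X]) : derivative (durr n f) =
    ((n : ℝ) + 1) • ∑ j ∈ Finset.range (n + 1),
      integ (bernsteinPolynomial ℝ n j * derivative f) • bernsteinPolynomial ℝ n j := by
  rw [durr_apply, derivative_sum_bernstein]
  congr 1
  refine Finset.sum_congr rfl fun j _ => ?_
  rw [durrCoef_apply, durrCoef_apply, Finset.sum_range_succ]
  congr 1
  ring

/-- The constant in the derivative formula for the operators `durr`. -/
def durrConst (N r : ℕ) : ℝ :=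
  ((N + r).factorial * (N + r + 1).factorial : ℝ) / (N.factorial * (N + 2 * r).factorial)

theorem durrConst_zero (N : ℕ) : durrConst N 0 = N + 1 := by
  have := Nat.factorial_ne_zero N
  simp only [durrConst, add_zero, mul_zero, Nat.factorial_succ]
  push_cast
  field_simp

theorem durrConst_succ (N r : ℕ) :
    durrConst N (r + 1) = durrConst (N + 1) r * (N + 1) / (N + 2 * r + 2) := by
  simp only [durrConst, show N + 1 + r = N + (r + 1) by ring,
    show N + 2 * (r + 1) = (N + 1 + 2 * r) + 1 by ring, Nat.factorial_succ]
  push_cast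
  have h1 : ((N + 1 + 2 * r : ℕ).factorial : ℝ) ≠ 0 := by positivity
  have h2 : ((N : ℕ).factorial : ℝ) ≠ 0 := by positivity
  have h3 : (N : ℝ) + 2 * r + 2 ≠ 0 := by positivity
  have h4 : (N : ℝ) + 1 + 2 * r + 1 ≠ 0 := by positivity
  field_simp
  ring

theorem iterate_derivative_durr (r N : ℕ) (f : ℝ[X]) :
    derivative^[r + 1] (durr (N + r) f) = durrConst N r • ∑ j ∈ Finset.range (N + 1),
      integ (bernsteinPolynomial ℝ (N + 2 * r) (j + r) * derivative^[r + 1] f) •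
        bernsteinPolynomial ℝ N j := by
  induction r generalizing N with
  | zero => simpa [durrConst_zero] using derivative_durr N f
  | succ r ih =>
    rw [Function.iterate_succ_apply', show N + (r + 1) = (N + 1) + r by ring, ih,
      derivative_smul, derivative_sum_bernstein, durrConst_succ, smul_smul, Finset.smul_sum,
      Finset.smul_sum]
    refine Finset.sum_congr rfl fun j hj => ?_
    rw [Finset.mem_range] at hj
    have h := integ_mul_derivative (bernsteinPolynomial ℝ (N + 2 * (r + 1)) (j + (r + 1)))
      (derivative^[r + 1] f)
    rw [← Function.iterate_succ_apply' derivative (r + 1) f,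
      show N + 2 * (r + 1) = (N + 1 + 2 * r) + 1 by ring, show j + (r + 1) = (j + r) + 1 by ring,
      derivative_bernstein_succ, bernsteinPolynomial.eval_at_0, bernsteinPolynomial.eval_at_1,
      if_neg (by omega), if_neg (by omega), smul_mul_assoc, map_smul, sub_mul, map_sub] at h
    rw [show j + 1 + r = j + r + 1 by ring, smul_smul, smul_smul,
      show N + 2 * (r + 1) = (N + 1 + 2 * r) + 1 by ring, show j + (r + 1) = (j + r) + 1 by ring,
      h]
    congr 1
    have h4 : (N : ℝ) + 2 * r + 2 ≠ 0 := by positivity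
    push_cast
    simp only [smul_eq_mul]
    field_simp
    ring

theorem durrCoef_last (n : ℕ) (f : ℝ[X]) : durrCoef n (n + 1) f = f.eval 1 := by
  rw [durrCoef_apply, ← map_sum, ← Finset.sum_mul, bernsteinPolynomial.sum, one_mul,
    integ_derivative]
  ring

theorem durrCoef_succ (N j : ℕ) (hj : j ≤ N) (f : ℝ[X]) :
    durrCoef (N + 1) (j + 1) f = (N + 1) * integ (bernsteinPolynomial ℝ N j * f) := by
  induction j with
  | zero =>
    rw [durrCoef_apply, Finset.sum_range_one, integ_mul_derivative, derivative_bernstein_zero,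
      bernsteinPolynomial.eval_at_0, bernsteinPolynomial.eval_at_1, neg_mul, map_neg,
      smul_mul_assoc, map_smul]
    simp
  | succ j ih =>
    have ih := ih (by omega)
    rw [durrCoef_apply] at ih ⊢
    rw [Finset.sum_range_succ, ← add_assoc, ih, integ_mul_derivative, derivative_bernstein_succ,
      bernsteinPolynomial.eval_at_0, bernsteinPolynomial.eval_at_1, if_neg (by omega),
      if_neg (by omega), smul_mul_assoc, map_smul, sub_mul, map_sub, smul_eq_mul]
    ring

theorem durr_zero_eval (f : ℝ[X]) (x : ℝ) :
    (durr 0 f).eval x = f.eval 0 * (1 - x) + f.eval 1 * x := by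
  rw [durr_apply]
  simp only [Finset.sum_range_succ, Finset.sum_range_zero, durrCoef_last, zero_add]
  simp [durrCoef_apply, bernsteinPolynomial]

theorem durr_succ_eval (N : ℕ) (f : ℝ[X]) (x : ℝ) :
    (durr (N + 1) f).eval x = f.eval 0 * (1 - x) ^ (N + 2) + f.eval 1 * x ^ (N + 2) +
      (N + 1) * ∑ j ∈ Finset.range (N + 1), integ (bernsteinPolynomial ℝ N j * f) *
        (bernsteinPolynomial ℝ (N + 2) (j + 1)).eval x := by
  rw [durr_apply, Finset.sum_range_succ, Finset.sum_range_succ', durrCoef_last, eval_add,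
    eval_add, eval_finsetSum]
  have : ∀ j ∈ Finset.range (N + 1),
      (durrCoef (N + 1) (j + 1) f • bernsteinPolynomial ℝ (N + 1 + 1) (j + 1)).eval x =
      (N + 1) * (integ (bernsteinPolynomial ℝ N j * f) *
        (bernsteinPolynomial ℝ (N + 2) (j + 1)).eval x) := by
    intro j hj
    rw [durrCoef_succ N j (by simpa [Nat.lt_succ_iff] using hj), eval_smul, smul_eq_mul, mul_assoc]
  rw [Finset.sum_congr rfl this, ← Finset.mul_sum]
  simp [durrCoef_apply, bernsteinPolynomial]
  ring

theorem durr_one (n : ℕ) : durr n 1 = 1 := by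
  rw [durr_apply]
  simp [durrCoef_apply, bernsteinPolynomial.sum]

theorem durr_X (n : ℕ) : durr n X = X := by
  have hn : (n : ℝ) + 1 ≠ 0 := by positivity
  have h : ∀ k ∈ Finset.range (n + 2), durrCoef n k X • bernsteinPolynomial ℝ (n + 1) k =
      (1 / ((n : ℝ) + 1)) • (k • bernsteinPolynomial ℝ (n + 1) k) := by
    intro k hk
    rw [Finset.mem_range] at hk
    have : durrCoef n k X = k * (1 / ((n : ℝ) + 1)) := by
      rw [durrCoef_apply, Finset.sum_congr rfl (g := fun _ => 1 / ((n : ℝ) + 1))]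
      · simp
      · intro j hj
        rw [Finset.mem_range] at hj
        rw [derivative_X, mul_one, integ_bernstein _ _ (by omega)]
    rw [this, ← Nat.cast_smul_eq_nsmul ℝ k, smul_smul, mul_comm]
  rw [durr_apply, Finset.sum_congr rfl h, ← Finset.smul_sum,
    bernsteinPolynomial.sum_smul ℝ (n + 1), ← Nat.cast_smul_eq_nsmul ℝ, smul_smul]
  push_cast
  rw [one_div_mul_cancel hn, one_smul]

theorem X_mul_bernstein (n j : ℕ) : X * bernsteinPolynomial ℝ n j =
    (((j : ℝ) + 1) / (n + 1)) • bernsteinPolynomial ℝ (n + 1) (j + 1) := by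
  have hn : (n : ℝ) + 1 ≠ 0 := by positivity
  have h : ((n : ℝ) + 1) * n.choose j = (n + 1).choose (j + 1) * (j + 1) := by
    exact_mod_cast Nat.add_one_mul_choose_eq n j
  have h2 : (n.choose j : ℝ) = ((j : ℝ) + 1) / (n + 1) * (n + 1).choose (j + 1) := by
    field_simp
    linarith
  refine Polynomial.funext fun x => ?_
  rw [eval_mul, eval_X, eval_smul, bernstein_eval, bernstein_eval, smul_eq_mul, h2,
    show n + 1 - (j + 1) = n - j by omega]
  ring

theorem durr_X_sq (n : ℕ) (x : ℝ) :
    (durr n (X ^ 2)).eval x = x ^ 2 + 2 / ((n : ℝ) + 2) * (x * (1 - x)) := by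
  have hn : (n : ℝ) + 1 ≠ 0 := by positivity
  have hn2 : (n : ℝ) + 2 ≠ 0 := by positivity
  have h : ∀ k ∈ Finset.range (n + 2), durrCoef n k (X ^ 2) • bernsteinPolynomial ℝ (n + 1) k =
      (1 / (((n : ℝ) + 1) * (n + 2))) • ((k * (k - 1)) • bernsteinPolynomial ℝ (n + 1) k +
        (2 : ℝ) • (k • bernsteinPolynomial ℝ (n + 1) k)) := by
    intro k hk
    rw [Finset.mem_range] at hk
    have : durrCoef n k (X ^ 2) = k * (k + 1) * (1 / (((n : ℝ) + 1) * (n + 2))) := by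
      rw [durrCoef_apply, Finset.sum_congr rfl
        (g := fun j : ℕ => ((j : ℝ) + 1) * (2 * (1 / (((n : ℝ) + 1) * (n + 2)))))]
      · rw [← Finset.sum_mul]
        have : ∀ k : ℕ, ∑ i ∈ Finset.range k, ((i : ℝ) + 1) = k * (k + 1) / 2 := by
          intro k
          induction k with
          | zero => simp
          | succ k ih => rw [Finset.sum_range_succ, ih]; push_cast; ring
        rw [this]
        simp
        ring
      · intro j hj
        rw [Finset.mem_range] at hj
        rw [derivative_X_pow, show (2 - 1 : ℕ) = 1 from rfl, pow_one,
          mul_left_comm, mul_comm _ X, X_mul_bernstein, ← smul_eq_C_mul, map_smul, map_smul,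
          integ_bernstein _ _ (by omega)]
        push_cast
        simp only [smul_eq_mul]
        field_simp
        ring
    rw [this, ← Nat.cast_smul_eq_nsmul ℝ k, ← Nat.cast_smul_eq_nsmul ℝ (k * (k - 1)), smul_smul,
      ← add_smul, smul_smul]
    congr 1
    have : ((k * (k - 1) : ℕ) : ℝ) = k * (k - 1) := by
      rcases k with - | k
      · simp
      · push_cast; simp
    rw [this]
    ring
  rw [durr_apply, Finset.sum_congr rfl h, ← Finset.smul_sum, Finset.sum_add_distrib,
    ← Finset.smul_sum, bernsteinPolynomial.sum_smul ℝ (n + 1),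
    bernsteinPolynomial.sum_mul_smul ℝ (n + 1)]
  simp
  field_simp
  ring

/-! ### The product formula -/

/-- Moments of the cosine with respect to the weight `sin ^ (2 r)` on `[0, π]`. -/
def cosMoment (r k : ℕ) : ℝ :=
  ∫ θ in (0 : ℝ)..Real.pi, Real.cos θ ^ k * Real.sin θ ^ (2 * r)

theorem cosMoment_zero_pos (r : ℕ) : 0 < cosMoment r 0 := by
  simpa [cosMoment] using integral_sin_pow_pos (2 * r)

theorem cosMoment_one (r : ℕ) : cosMoment r 1 = 0 := by
  have h : ∀ θ ∈ uIcc (0 : ℝ) Real.pi,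
      HasDerivAt (fun θ => Real.sin θ ^ (2 * r + 1) / (2 * r + 1))
        (Real.cos θ ^ 1 * Real.sin θ ^ (2 * r)) θ := by
    intro θ _
    have h := ((Real.hasDerivAt_sin θ).pow (2 * r + 1)).div_const (2 * (r : ℝ) + 1)
    have : (2 * (r : ℝ) + 1) ≠ 0 := by positivity
    refine h.congr_deriv ?_
    push_cast
    field_simp
  rw [cosMoment, intervalIntegral.integral_eq_sub_of_hasDerivAt h
    (Continuous.intervalIntegrable (by fun_prop) _ _)]
  simp

theorem cosMoment_add_two (r k : ℕ) :
    (k + 2 * r + 2) * cosMoment r (k + 2) = (k + 1) * cosMoment r k := by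
  have h : ∀ θ ∈ uIcc (0 : ℝ) Real.pi,
      HasDerivAt (fun θ => Real.cos θ ^ (k + 1) * Real.sin θ ^ (2 * r + 1))
        ((k + 2 * r + 2) * (Real.cos θ ^ (k + 2) * Real.sin θ ^ (2 * r)) -
          (k + 1) * (Real.cos θ ^ k * Real.sin θ ^ (2 * r))) θ := by
    intro θ _
    have h := ((Real.hasDerivAt_cos θ).pow (k + 1)).mul ((Real.hasDerivAt_sin θ).pow (2 * r + 1))
    refine h.congr_deriv ?_
    push_cast
    simp only [Pi.pow_apply]
    have := Real.sin_sq_add_cos_sq θ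
    linear_combination (-(k + 1) : ℝ) * (Real.cos θ ^ k * Real.sin θ ^ (2 * r)) * this
  have h2 := intervalIntegral.integral_eq_sub_of_hasDerivAt h
    (Continuous.intervalIntegrable (by fun_prop) _ _)
  rw [intervalIntegral.integral_sub (Continuous.intervalIntegrable (by fun_prop) _ _)
    (Continuous.intervalIntegrable (by fun_prop) _ _), intervalIntegral.integral_const_mul,
    intervalIntegral.integral_const_mul] at h2
  simp at h2
  simp only [cosMoment]
  linarith

theorem cosMoment_odd (r i : ℕ) : cosMoment r (2 * i + 1) = 0 := by
  induction i with
  | zero => exact cosMoment_one r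
  | succ i ih =>
    have h := cosMoment_add_two r (2 * i + 1)
    rw [ih, mul_zero] at h
    exact (mul_eq_zero.1 h).resolve_left (by positivity)

theorem cosMoment_even (r i : ℕ) : cosMoment r (2 * i) =
    cosMoment r 0 * ((2 * i).factorial * r.factorial / (4 ^ i * i.factorial * (i + r).factorial)) := by
  induction i with
  | zero =>
    have : (r.factorial : ℝ) ≠ 0 := by positivity
    simp [this]
  | succ i ih =>
    have h := cosMoment_add_two r (2 * i)
    rw [ih] at h
    have h1 : ((2 * i + 2 * r + 2 : ℝ)) ≠ 0 := by positivity
    have h2 : ((i : ℝ) + 1 + r) ≠ 0 := by positivity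
    have h3 : ((i + r).factorial : ℝ) ≠ 0 := by positivity
    have h4 : (i.factorial : ℝ) ≠ 0 := by positivity
    push_cast at h
    rw [show 2 * (i + 1) = 2 * i + 2 by ring, show i + 1 + r = (i + r) + 1 by ring]
    refine mul_left_cancel₀ h1 (h.trans ?_)
    simp only [Nat.factorial_succ]
    push_cast
    field_simp
    ring

theorem sum_choose_mul_choose_add (j M r : ℕ) :
    ∑ i ∈ Finset.range (j + 1), j.choose i * M.choose (i + r) = (M + j).choose (j + r) := by
  induction j generalizing r with
  | zero => simp
  | succ j ih =>
    have h1 := ih r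
    have h2 := ih (r + 1)
    rw [Finset.sum_range_succ']
    simp only [Nat.choose_succ_succ j, add_mul, Finset.sum_add_distrib]
    rw [Finset.sum_range_succ (fun i => j.choose (i + 1) * M.choose (i + 1 + r)),
      Nat.choose_succ_self, zero_mul, add_zero]
    rw [Finset.sum_range_succ'] at h1
    have h3 : (M + (j + 1)).choose (j + 1 + r) =
        (M + j).choose (j + r) + (M + j).choose (j + (r + 1)) := by
      rw [show M + (j + 1) = (M + j) + 1 by ring, show j + 1 + r = (j + r) + 1 by ring,
        Nat.choose_succ_succ]
      rfl
    rw [h3, ← h1, ← h2]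
    simp only [show ∀ i, i + 1 + r = i + (r + 1) by intro i; ring]
    simp
    ring

theorem sum_range_two_mul (g : ℕ → ℝ) (M : ℕ) :
    ∑ k ∈ Finset.range (2 * M), g k = ∑ i ∈ Finset.range M, (g (2 * i) + g (2 * i + 1)) := by
  induction M with
  | zero => simp
  | succ M ih =>
    rw [show 2 * (M + 1) = 2 * M + 1 + 1 by ring, Finset.sum_range_succ, Finset.sum_range_succ, ih,
      Finset.sum_range_succ]
    ring

theorem mul_pow_mul_add_pow (a b : ℝ) {N i : ℕ} (h : 2 * i ≤ N) :
    (a * b) ^ i * (a + b) ^ (N - 2 * i) = ∑ j ∈ Finset.range (N + 1),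
      if i ≤ j then ((N - 2 * i).choose (j - i) : ℝ) * (a ^ j * b ^ (N - j)) else 0 := by
  obtain ⟨M, rfl⟩ := Nat.exists_eq_add_of_le h
  rw [show 2 * i + M + 1 = i + ((M + 1) + i) by ring, Finset.sum_range_add, Finset.sum_range_add,
    Nat.add_sub_cancel_left, add_pow, Finset.mul_sum]
  rw [Finset.sum_eq_zero (s := Finset.range i), Finset.sum_eq_zero (s := Finset.range i), zero_add,
    add_zero]
  · refine Finset.sum_congr rfl fun l hl => ?_
    rw [Finset.mem_range] at hl
    rw [if_pos (by omega), Nat.add_sub_cancel_left,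
      show 2 * i + M - (i + l) = i + (M - l) by omega]
    ring
  · intro l _
    rw [if_pos (by omega), Nat.choose_eq_zero_of_lt (by omega)]
    simp
  · intro l hl
    rw [Finset.mem_range] at hl
    rw [if_neg (by omega)]

theorem product_coeff (N r j i : ℕ) (hj : j ≤ N) (hi : 2 * i ≤ N) :
    ((N.choose (2 * i) : ℝ) * ((2 * i).factorial * r.factorial /
      (i.factorial * (i + r).factorial))) *
        (if i ≤ j then ((N - 2 * i).choose (j - i) : ℝ) else 0) =
      (N.factorial * r.factorial / (j.factorial * (N - j + r).factorial)) *
        (j.choose i * (N - j + r).choose (i + r)) := by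
  split_ifs with hij
  · rcases le_or_gt i (N - j) with h | h
    · obtain ⟨p, rfl⟩ := Nat.exists_eq_add_of_le hij
      obtain ⟨s, rfl⟩ : ∃ s, N = i + p + (i + s) := ⟨N - (i + p) - i, by omega⟩
      rw [show i + p + (i + s) - 2 * i = p + s by omega,
        show i + p - i = p by omega, show i + p + (i + s) - (i + p) + r = (i + r) + s by omega,
        show i + p + (i + s) = 2 * i + (p + s) by omega,
        Nat.cast_add_choose, Nat.cast_add_choose, Nat.cast_add_choose, Nat.cast_add_choose]
      field_simp
    · rw [Nat.choose_eq_zero_of_lt (show N - 2 * i < j - i by omega),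
        Nat.choose_eq_zero_of_lt (show N - j + r < i + r by omega)]
      simp
  · rw [Nat.choose_eq_zero_of_lt (show j < i by omega)]
    simp

theorem sum_product_coeff (N r j : ℕ) (hj : j ≤ N) :
    ∑ i ∈ Finset.range (N + 1), (if 2 * i ≤ N then
      ((N.choose (2 * i) : ℝ) * ((2 * i).factorial * r.factorial /
        (i.factorial * (i + r).factorial))) *
        (if i ≤ j then ((N - 2 * i).choose (j - i) : ℝ) else 0) else 0) =
      N.choose j * (N + 2 * r).choose (j + r) / (N + 2 * r).choose r := by
  have h : ∀ i ∈ Finset.range (N + 1), (if 2 * i ≤ N then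
      ((N.choose (2 * i) : ℝ) * ((2 * i).factorial * r.factorial /
        (i.factorial * (i + r).factorial))) *
        (if i ≤ j then ((N - 2 * i).choose (j - i) : ℝ) else 0) else 0) =
      (N.factorial * r.factorial / (j.factorial * (N - j + r).factorial)) *
        (j.choose i * (N - j + r).choose (i + r)) := by
    intro i _
    split_ifs with h1 h2
    · simpa [h2] using product_coeff N r j i hj h1
    · simpa [h2] using product_coeff N r j i hj h1
    · rcases le_or_gt i j with h2 | h2
      · rw [Nat.choose_eq_zero_of_lt (show N - j + r < i + r by omega)]
        simp
      · rw [Nat.choose_eq_zero_of_lt h2]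
        simp
  rw [Finset.sum_congr rfl h, ← Finset.mul_sum]
  have h2 : ∑ i ∈ Finset.range (N + 1), ((j.choose i : ℝ) * (N - j + r).choose (i + r)) =
      (N - j + r + j).choose (j + r) := by
    rw [← sum_choose_mul_choose_add]
    push_cast
    refine (Finset.sum_subset (Finset.range_subset_range.2 (by omega)) fun i _ hi => ?_).symm
    rw [Finset.mem_range] at hi
    rw [Nat.choose_eq_zero_of_lt (show j < i by omega)]
    simp
  rw [h2]
  obtain ⟨M, rfl⟩ := Nat.exists_eq_add_of_le hj
  rw [show j + M - j + r + j = (j + r) + M by omega, show j + M - j + r = M + r by omega,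
    show (j + M + 2 * r).choose (j + r) = ((j + r) + (M + r)).choose (j + r) by congr 1; ring,
    show (j + M + 2 * r).choose r = (r + (j + r + M)).choose r by congr 1; ring,
    Nat.cast_add_choose, Nat.cast_add_choose, Nat.cast_add_choose, Nat.cast_add_choose,
    show (j + r) + (M + r) = r + (j + r + M) by ring]
  field_simp

theorem integral_pow_mul_sin_pow (N r : ℕ) (a b s : ℝ) (hs : s ^ 2 = a * b) :
    ∫ θ in (0 : ℝ)..Real.pi, (a + b + 2 * s * Real.cos θ) ^ N * Real.sin θ ^ (2 * r) =
      cosMoment r 0 / (N + 2 * r).choose r * ∑ j ∈ Finset.range (N + 1),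
        N.choose j * (N + 2 * r).choose (j + r) * (a ^ j * b ^ (N - j)) := by
  set g : ℕ → ℝ := fun k => (2 * s) ^ k * (a + b) ^ (N - k) * N.choose k * cosMoment r k with hg
  have h1 : ∫ θ in (0 : ℝ)..Real.pi, (a + b + 2 * s * Real.cos θ) ^ N * Real.sin θ ^ (2 * r) =
      ∑ k ∈ Finset.range (N + 1), g k := by
    have : ∀ θ : ℝ, (a + b + 2 * s * Real.cos θ) ^ N * Real.sin θ ^ (2 * r) =
        ∑ k ∈ Finset.range (N + 1), ((2 * s) ^ k * (a + b) ^ (N - k) * N.choose k) *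
          (Real.cos θ ^ k * Real.sin θ ^ (2 * r)) := by
      intro θ
      rw [add_comm, add_pow, Finset.sum_mul]
      refine Finset.sum_congr rfl fun k _ => ?_
      ring
    simp only [this]
    rw [intervalIntegral.integral_finsetSum
      fun k _ => Continuous.intervalIntegrable (by fun_prop) _ _]
    simp only [intervalIntegral.integral_const_mul, hg, cosMoment]
  have h2 : ∑ k ∈ Finset.range (N + 1), g k = ∑ i ∈ Finset.range (N + 1), g (2 * i) := by
    have : ∑ k ∈ Finset.range (N + 1), g k = ∑ k ∈ Finset.range (2 * (N + 1)), g k := by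
      refine Finset.sum_subset (Finset.range_subset_range.2 (by omega)) fun k _ hk => ?_
      rw [Finset.mem_range] at hk
      simp [hg, Nat.choose_eq_zero_of_lt (show N < k by omega)]
    rw [this, sum_range_two_mul]
    simp [hg, cosMoment_odd]
  have h3 : ∀ i ∈ Finset.range (N + 1), g (2 * i) =
      cosMoment r 0 * ∑ j ∈ Finset.range (N + 1), (if 2 * i ≤ N then
      ((N.choose (2 * i) : ℝ) * ((2 * i).factorial * r.factorial /
        (i.factorial * (i + r).factorial))) *
        (if i ≤ j then ((N - 2 * i).choose (j - i) : ℝ) else 0) else 0) *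
          (a ^ j * b ^ (N - j)) := by
    intro i _
    split_ifs with h
    · have := mul_pow_mul_add_pow a b h
      simp only [mul_assoc _ (ite _ _ _) _, ite_mul, zero_mul]
      rw [← Finset.mul_sum, ← this]
      simp only [hg]
      rw [cosMoment_even, pow_mul, mul_pow, hs, mul_pow]
      field_simp
      norm_num
      ring
    · simp [hg, Nat.choose_eq_zero_of_lt (show N < 2 * i by omega)]
  rw [h1, h2, Finset.sum_congr rfl h3, ← Finset.mul_sum, Finset.sum_comm, div_mul_eq_mul_div,
    mul_div_assoc, Finset.sum_div]
  congr 1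
  refine Finset.sum_congr rfl fun j hj => ?_
  rw [Finset.mem_range] at hj
  rw [← Finset.sum_mul, sum_product_coeff N r j (by omega)]
  ring

/-! ### The kernel of the Durrmeyer operators -/

/-- The argument appearing in the product formula. -/
def kernelArg (x t θ : ℝ) : ℝ :=
  x * t + (1 - x) * (1 - t) + 2 * Real.sqrt (x * t * ((1 - x) * (1 - t))) * Real.cos θ

theorem continuous_kernelArg (x t : ℝ) : Continuous (kernelArg x t) := by
  unfold kernelArg
  fun_prop

theorem kernelArg_mem {x t : ℝ} (hx : x ∈ Icc (0 : ℝ) 1) (ht : t ∈ Icc (0 : ℝ) 1) (θ : ℝ) :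
    kernelArg x t θ ∈ Icc (0 : ℝ) 1 := by
  obtain ⟨hx0, hx1⟩ := hx
  obtain ⟨ht0, ht1⟩ := ht
  have ha : 0 ≤ x * t := mul_nonneg hx0 ht0
  have hb : 0 ≤ (1 - x) * (1 - t) := mul_nonneg (by linarith) (by linarith)
  have hs := Real.sq_sqrt (mul_nonneg ha hb)
  have hs0 := Real.sqrt_nonneg (x * t * ((1 - x) * (1 - t)))
  unfold kernelArg
  set s := Real.sqrt (x * t * ((1 - x) * (1 - t)))
  have h1 : 2 * s ≤ x * t + (1 - x) * (1 - t) :=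
    abs_le_of_sq_le_sq' (by nlinarith [sq_nonneg (x * t - (1 - x) * (1 - t))]) (by linarith) |>.2
  have h2 : 2 * s ≤ x * (1 - t) + (1 - x) * t := by
    refine abs_le_of_sq_le_sq' ?_ ?_ |>.2
    · nlinarith [sq_nonneg (x * (1 - t) - (1 - x) * t)]
    · exact add_nonneg (mul_nonneg hx0 (by linarith)) (mul_nonneg (by linarith) ht0)
  have hc1 := mul_le_mul_of_nonneg_left (Real.cos_le_one θ) hs0
  have hc2 := mul_le_mul_of_nonneg_left (Real.neg_one_le_cos θ) hs0
  constructor <;> nlinarith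

/-- The average of a polynomial against `sin ^ (2 r)` along the arguments `kernelArg x t`. -/
def angAvg (r : ℕ) (x t : ℝ) : ℝ[X] →ₗ[ℝ] ℝ where
  toFun Q := ∫ θ in (0 : ℝ)..Real.pi, Q.eval (kernelArg x t θ) * Real.sin θ ^ (2 * r)
  map_add' Q R := by
    have := continuous_kernelArg x t
    simp only [eval_add, add_mul]
    exact intervalIntegral.integral_add (Continuous.intervalIntegrable (by fun_prop) _ _)
      (Continuous.intervalIntegrable (by fun_prop) _ _)
  map_smul' c Q := by
    simp [intervalIntegral.integral_const_mul, mul_assoc]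

theorem angAvg_nonneg (r : ℕ) {x t : ℝ} (hx : x ∈ Icc (0 : ℝ) 1) (ht : t ∈ Icc (0 : ℝ) 1)
    {Q : ℝ[X]} (hQ : ∀ u ∈ Icc (0 : ℝ) 1, 0 ≤ Q.eval u) : 0 ≤ angAvg r x t Q := by
  refine intervalIntegral.integral_nonneg Real.pi_pos.le fun θ hθ => ?_
  exact mul_nonneg (hQ _ (kernelArg_mem hx ht θ))
    (pow_nonneg (Real.sin_nonneg_of_nonneg_of_le_pi hθ.1 hθ.2) _)

theorem durrConst_mul_sum (N r : ℕ) {x t : ℝ} (hx : x ∈ Icc (0 : ℝ) 1)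
    (ht : t ∈ Icc (0 : ℝ) 1) :
    durrConst N r * ∑ j ∈ Finset.range (N + 1), (bernsteinPolynomial ℝ (N + 2 * r) (j + r)).eval t *
      (bernsteinPolynomial ℝ N j).eval x =
    (t * (1 - t)) ^ r / (r.factorial * cosMoment r 0) *
      angAvg r x t (derivative^[r + 1] (X ^ (N + r + 1))) := by
  have hs : Real.sqrt (x * t * ((1 - x) * (1 - t))) ^ 2 = x * t * ((1 - x) * (1 - t)) :=
    Real.sq_sqrt (mul_nonneg (mul_nonneg hx.1 ht.1)
      (mul_nonneg (sub_nonneg.2 hx.2) (sub_nonneg.2 ht.2)))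
  have hm := cosMoment_zero_pos r
  have hd : (((N + r + 1).descFactorial (r + 1) : ℕ) : ℝ) = (N + r + 1).factorial / N.factorial := by
    rw [eq_div_iff (by positivity), mul_comm]
    have := Nat.factorial_mul_descFactorial (show r + 1 ≤ N + r + 1 by omega)
    rw [show N + r + 1 - (r + 1) = N by omega] at this
    exact_mod_cast this
  have h1 : angAvg r x t (derivative^[r + 1] (X ^ (N + r + 1))) =
      (N + r + 1).factorial / N.factorial * (cosMoment r 0 / (N + 2 * r).choose r *
        ∑ j ∈ Finset.range (N + 1), N.choose j * (N + 2 * r).choose (j + r) *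
          ((x * t) ^ j * ((1 - x) * (1 - t)) ^ (N - j))) := by
    rw [← integral_pow_mul_sin_pow N r _ _ _ hs, ← hd, ← intervalIntegral.integral_const_mul,
      iterate_derivative_X_pow_eq_natCast_mul, show N + r + 1 - (r + 1) = N by omega]
    refine intervalIntegral.integral_congr fun θ _ => ?_
    simp [kernelArg, mul_assoc]
  have h2 : ∑ j ∈ Finset.range (N + 1), (bernsteinPolynomial ℝ (N + 2 * r) (j + r)).eval t *
      (bernsteinPolynomial ℝ N j).eval x = (t * (1 - t)) ^ r *
        ∑ j ∈ Finset.range (N + 1), N.choose j * (N + 2 * r).choose (j + r) *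
          ((x * t) ^ j * ((1 - x) * (1 - t)) ^ (N - j)) := by
    rw [Finset.mul_sum]
    refine Finset.sum_congr rfl fun j hj => ?_
    rw [Finset.mem_range] at hj
    rw [bernstein_eval, bernstein_eval, show N + 2 * r - (j + r) = N - j + r by omega]
    simp only [mul_pow, pow_add]
    ring
  rw [h1, h2, durrConst, show N + 2 * r = r + (N + r) by ring, Nat.cast_add_choose]
  field_simp

theorem exists_kernel_iterate_derivative_durr (n r : ℕ) {x : ℝ} (hx : x ∈ Icc (0 : ℝ) 1) :
    ∃ K : ℝ[X], (∀ f, (derivative^[r + 1] (durr n f)).eval x =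
      integ (K * derivative^[r + 1] f)) ∧ ∀ t ∈ Icc (0 : ℝ) 1, K.eval t =
        (t * (1 - t)) ^ r / (r.factorial * cosMoment r 0) *
          angAvg r x t (derivative^[r + 1] (X ^ (n + 1))) := by
  rcases lt_or_ge n r with h | h
  · refine ⟨0, fun f => ?_, fun t _ => ?_⟩
    · rw [iterate_derivative_eq_zero ((natDegree_durr_le n f).trans_lt (by omega))]
      simp
    · rw [iterate_derivative_eq_zero (by rw [natDegree_X_pow]; omega)]
      simp
  · obtain ⟨N, rfl⟩ := Nat.exists_eq_add_of_le' h
    refine ⟨durrConst N r • ∑ j ∈ Finset.range (N + 1), (bernsteinPolynomial ℝ N j).eval x •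
      bernsteinPolynomial ℝ (N + 2 * r) (j + r), fun f => ?_, fun t ht => ?_⟩
    · rw [iterate_derivative_durr, smul_mul_assoc, Finset.sum_mul, map_smul, map_sum]
      simp only [smul_mul_assoc, map_smul, eval_smul, eval_finsetSum, smul_eq_mul]
      congr 1
      exact Finset.sum_congr rfl fun j _ => mul_comm _ _
    · rw [← durrConst_mul_sum N r hx ht]
      simp only [eval_smul, eval_finsetSum, smul_eq_mul]
      congr 1
      exact Finset.sum_congr rfl fun j _ => mul_comm _ _

theorem exists_kernel_durr (n : ℕ) {x : ℝ} (hx : x ∈ Icc (0 : ℝ) 1) :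
    ∃ K : ℝ[X], (∀ f, (durr n f).eval x =
      f.eval 0 * (1 - x) ^ (n + 1) + f.eval 1 * x ^ (n + 1) + integ (K * f)) ∧
      ∀ t ∈ Icc (0 : ℝ) 1, K.eval t = x * (1 - x) / cosMoment 1 0 *
          angAvg 1 t x (derivative^[2] (X ^ (n + 1))) := by
  cases n with
  | zero =>
    refine ⟨0, fun f => ?_, fun t _ => ?_⟩
    · rw [durr_zero_eval]
      simp
    · simp
  | succ N =>
    refine ⟨((N : ℝ) + 1) • ∑ j ∈ Finset.range (N + 1),
      (bernsteinPolynomial ℝ (N + 2) (j + 1)).eval x • bernsteinPolynomial ℝ N j,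
      fun f => ?_, fun t ht => ?_⟩
    · rw [durr_succ_eval, smul_mul_assoc, Finset.sum_mul, map_smul, map_sum]
      simp only [smul_mul_assoc, map_smul, smul_eq_mul]
      congr 2
      exact Finset.sum_congr rfl fun j _ => mul_comm _ _
    · have h := durrConst_mul_sum N 1 ht hx
      have hc : durrConst N 1 = N + 1 := by
        simp only [durrConst, mul_one, Nat.factorial_succ]
        push_cast
        field_simp
      rw [hc] at h
      simp only [pow_one, Nat.factorial_one, Nat.cast_one, one_mul, mul_one] at h
      rw [← h]
      simp only [eval_smul, eval_finsetSum, smul_eq_mul]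

/-! ### Mixtures of the Durrmeyer operators -/

/-- The combination of the Durrmeyer operators with the coefficients of `P` as weights. -/
def conv (P : ℝ[X]) : ℝ[X] →ₗ[ℝ] ℝ[X] :=
  ∑ n ∈ Finset.range P.natDegree, P.coeff (n + 1) • durr n

theorem conv_apply (P f : ℝ[X]) :
    conv P f = ∑ n ∈ Finset.range P.natDegree, P.coeff (n + 1) • durr n f := by
  simp [conv, LinearMap.sum_apply]

theorem eq_sum_of_eval_zero {P : ℝ[X]} (hP : P.eval 0 = 0) :
    P = ∑ n ∈ Finset.range P.natDegree, P.coeff (n + 1) • X ^ (n + 1) := by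
  conv_lhs => rw [P.as_sum_range' (P.natDegree + 1) (by omega)]
  rw [Finset.sum_range_succ', coeff_zero_eq_eval_zero, hP]
  simp [← C_mul_X_pow_eq_monomial, smul_eq_C_mul]

theorem natDegree_conv_le (P f : ℝ[X]) : (conv P f).natDegree ≤ P.natDegree := by
  rw [conv_apply]
  refine natDegree_sum_le_of_forall_le _ _ fun n hn => ?_
  rw [Finset.mem_range] at hn
  exact (natDegree_smul_le _ _).trans ((natDegree_durr_le n f).trans hn)

theorem eval_iterate_derivative_conv_nonneg {P : ℝ[X]} (hP : P.eval 0 = 0) (r : ℕ)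
    (hd : ∀ u ∈ Icc (0 : ℝ) 1, 0 ≤ (derivative^[r + 1] P).eval u) {f : ℝ[X]}
    (hf : ∀ u ∈ Icc (0 : ℝ) 1, 0 ≤ (derivative^[r + 1] f).eval u) {x : ℝ}
    (hx : x ∈ Icc (0 : ℝ) 1) : 0 ≤ (derivative^[r + 1] (conv P f)).eval x := by
  choose K hK1 hK2 using fun n => exists_kernel_iterate_derivative_durr n r hx
  have h1 : (derivative^[r + 1] (conv P f)).eval x =
      integ ((∑ n ∈ Finset.range P.natDegree, P.coeff (n + 1) • K n) * derivative^[r + 1] f) := by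
    rw [conv_apply, iterate_derivative_sum, eval_finsetSum, Finset.sum_mul, map_sum]
    refine Finset.sum_congr rfl fun n _ => ?_
    rw [iterate_derivative_smul, eval_smul, hK1, smul_mul_assoc, map_smul]
  rw [h1]
  refine integ_nonneg fun t ht => ?_
  rw [eval_mul]
  refine mul_nonneg ?_ (hf t ht)
  have h2 : (∑ n ∈ Finset.range P.natDegree, P.coeff (n + 1) • K n).eval t =
      (t * (1 - t)) ^ r / (r.factorial * cosMoment r 0) * angAvg r x t (derivative^[r + 1] P) := by
    conv_rhs => rw [eq_sum_of_eval_zero hP]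
    rw [iterate_derivative_sum, map_sum, Finset.mul_sum, eval_finsetSum]
    refine Finset.sum_congr rfl fun n _ => ?_
    rw [iterate_derivative_smul, map_smul, eval_smul, hK2 n t ht]
    simp only [smul_eq_mul]
    ring
  rw [h2]
  have := cosMoment_zero_pos r
  have := mul_nonneg ht.1 (sub_nonneg.2 ht.2)
  exact mul_nonneg (by positivity) (angAvg_nonneg r hx ht hd)

theorem eval_conv_nonneg {P : ℝ[X]} (hP : P.eval 0 = 0)
    (h0 : ∀ u ∈ Icc (0 : ℝ) 1, 0 ≤ P.eval u)
    (hd : ∀ u ∈ Icc (0 : ℝ) 1, 0 ≤ (derivative^[2] P).eval u) {f : ℝ[X]}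
    (hf : ∀ u ∈ Icc (0 : ℝ) 1, 0 ≤ f.eval u) {x : ℝ}
    (hx : x ∈ Icc (0 : ℝ) 1) : 0 ≤ (conv P f).eval x := by
  choose K hK1 hK2 using fun n => exists_kernel_durr n hx
  have hPe : ∀ y, P.eval y = ∑ n ∈ Finset.range P.natDegree, P.coeff (n + 1) * y ^ (n + 1) := by
    intro y
    conv_lhs => rw [eq_sum_of_eval_zero hP]
    simp [eval_finsetSum]
  have h1 : (conv P f).eval x = f.eval 0 * P.eval (1 - x) + f.eval 1 * P.eval x +
      integ ((∑ n ∈ Finset.range P.natDegree, P.coeff (n + 1) • K n) * f) := by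
    rw [conv_apply, eval_finsetSum, Finset.sum_mul, map_sum, hPe, hPe, Finset.mul_sum,
      Finset.mul_sum, ← Finset.sum_add_distrib, ← Finset.sum_add_distrib]
    refine Finset.sum_congr rfl fun n _ => ?_
    rw [eval_smul, hK1, smul_mul_assoc, map_smul]
    simp only [smul_eq_mul]
    ring
  rw [h1]
  have h2 : ∀ t ∈ Icc (0 : ℝ) 1,
      (∑ n ∈ Finset.range P.natDegree, P.coeff (n + 1) • K n).eval t =
      x * (1 - x) / cosMoment 1 0 * angAvg 1 t x (derivative^[2] P) := by
    intro t ht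
    conv_rhs => rw [eq_sum_of_eval_zero hP]
    rw [iterate_derivative_sum, map_sum, Finset.mul_sum, eval_finsetSum]
    refine Finset.sum_congr rfl fun n _ => ?_
    rw [iterate_derivative_smul, map_smul, eval_smul, hK2 n t ht]
    simp only [smul_eq_mul]
    ring
  have hx' : 0 ≤ 1 - x := sub_nonneg.2 hx.2
  refine add_nonneg (add_nonneg (mul_nonneg (hf 0 (by simp)) (h0 _ ⟨hx', by linarith [hx.1]⟩))
    (mul_nonneg (hf 1 (by simp)) (h0 x hx))) (integ_nonneg fun t ht => ?_)
  rw [eval_mul, h2 t ht]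
  have := cosMoment_zero_pos 1
  have := hx.1
  exact mul_nonneg (mul_nonneg (by positivity) (angAvg_nonneg 1 ht hx hd)) (hf t ht)

theorem sum_coeff_eq_one {P : ℝ[X]} (h0 : P.eval 0 = 0) (h1 : P.eval 1 = 1) :
    ∑ n ∈ Finset.range P.natDegree, P.coeff (n + 1) = 1 := by
  conv_rhs => rw [← h1, eq_sum_of_eval_zero h0]
  simp [eval_finsetSum]

theorem conv_one {P : ℝ[X]} (h0 : P.eval 0 = 0) (h1 : P.eval 1 = 1) : conv P 1 = 1 := by
  rw [conv_apply]
  simp only [durr_one]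
  rw [← Finset.sum_smul, sum_coeff_eq_one h0 h1, one_smul]

theorem conv_X {P : ℝ[X]} (h0 : P.eval 0 = 0) (h1 : P.eval 1 = 1) : conv P X = X := by
  rw [conv_apply]
  simp only [durr_X]
  rw [← Finset.sum_smul, sum_coeff_eq_one h0 h1, one_smul]

theorem conv_X_sq_eval {P : ℝ[X]} (h0 : P.eval 0 = 0) (h1 : P.eval 1 = 1) (x : ℝ) :
    (conv P (X ^ 2)).eval x = x ^ 2 + 2 * integ P * (x * (1 - x)) := by
  have hi : integ P = ∑ n ∈ Finset.range P.natDegree, P.coeff (n + 1) * (1 / (n + 2)) := by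
    conv_lhs => rw [eq_sum_of_eval_zero h0]
    rw [map_sum]
    refine Finset.sum_congr rfl fun n _ => ?_
    rw [map_smul, integ_apply, smul_eq_mul]
    simp
    norm_num [add_assoc]
  have hs := sum_coeff_eq_one h0 h1
  rw [conv_apply, eval_finsetSum, hi]
  simp only [eval_smul, durr_X_sq, smul_eq_mul, mul_add, Finset.sum_add_distrib]
  rw [← Finset.sum_mul, hs, one_mul, Finset.mul_sum, Finset.sum_mul]
  congr 1
  refine Finset.sum_congr rfl fun n _ => ?_
  ring

theorem conv_eval_zero {P : ℝ[X]} (h0 : P.eval 0 = 0) (h1 : P.eval 1 = 1) (f : ℝ[X]) :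
    (conv P f).eval 0 = f.eval 0 := by
  have h : ∀ n, (durr n f).eval 0 = f.eval 0 := by
    rintro (_ | n)
    · simp [durr_zero_eval]
    · simp [durr_succ_eval, bernstein_eval]
  rw [conv_apply, eval_finsetSum]
  simp only [eval_smul, h, smul_eq_mul]
  rw [← Finset.sum_mul, sum_coeff_eq_one h0 h1, one_mul]

theorem conv_eval_one {P : ℝ[X]} (h0 : P.eval 0 = 0) (h1 : P.eval 1 = 1) (f : ℝ[X]) :
    (conv P f).eval 1 = f.eval 1 := by
  have h : ∀ n, (durr n f).eval 1 = f.eval 1 := by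
    rintro (_ | n)
    · simp [durr_zero_eval]
    · rw [durr_succ_eval, Finset.sum_eq_zero]
      · simp
      · intro j hj
        rw [Finset.mem_range] at hj
        simp [bernstein_eval, show n + 1 - j ≠ 0 by omega]
  rw [conv_apply, eval_finsetSum]
  simp only [eval_smul, h, smul_eq_mul]
  rw [← Finset.sum_mul, sum_coeff_eq_one h0 h1, one_mul]

/-! ### Polynomial weights with nonnegative derivatives -/

theorem exists_derivative_eq (Q : ℝ[X]) :
    ∃ A : ℝ[X], derivative A = Q ∧ A.eval 0 = 0 ∧ A.natDegree ≤ Q.natDegree + 1 := by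
  refine ⟨∑ i ∈ Finset.range (Q.natDegree + 1), C (Q.coeff i / (i + 1)) * X ^ (i + 1), ?_, ?_, ?_⟩
  · conv_rhs => rw [Q.as_sum_range_C_mul_X_pow]
    rw [derivative_sum]
    refine Finset.sum_congr rfl fun i _ => ?_
    rw [derivative_C_mul_X_pow]
    have : (i : ℝ) + 1 ≠ 0 := by positivity
    congr 2
    push_cast
    field_simp
  · simp [eval_finsetSum]
  · refine natDegree_sum_le_of_forall_le _ _ fun i hi => ?_
    rw [Finset.mem_range] at hi
    exact (natDegree_C_mul_X_pow_le _ _).trans (by omega)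

theorem eval_nonneg_of_derivative {A : ℝ[X]} (h0 : A.eval 0 = 0)
    (h : ∀ u ∈ Icc (0 : ℝ) 1, 0 ≤ (derivative A).eval u) :
    ∀ u ∈ Icc (0 : ℝ) 1, 0 ≤ A.eval u := by
  have hm : MonotoneOn (fun u => A.eval u) (Icc (0 : ℝ) 1) := by
    refine monotoneOn_of_deriv_nonneg (convex_Icc 0 1) A.continuous.continuousOn
      A.differentiable.differentiableOn fun u hu => ?_
    rw [A.deriv]
    exact h u (interior_subset hu)
  intro u hu
  rw [← h0]
  exact hm (by simp) hu hu.1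

theorem integ_one_sub_pow_mul {A : ℝ[X]} (h0 : A.eval 0 = 0) (k : ℕ) :
    (k + 1) * integ ((1 - X) ^ k * A) = integ ((1 - X) ^ (k + 1) * derivative A) := by
  have h := integ_derivative ((1 - X) ^ (k + 1) * A)
  have e : derivative ((1 - X) ^ (k + 1) * A) =
      (1 - X) ^ (k + 1) * derivative A - ((k : ℝ) + 1) • ((1 - X) ^ k * A) := by
    rw [derivative_mul, derivative_pow, smul_eq_C_mul]
    simp
    ring
  rw [e, map_sub, map_smul, smul_eq_mul] at h
  simp only [eval_mul, eval_pow, eval_sub, eval_one, eval_X, h0, sub_self] at h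
  simp at h
  linarith

theorem exists_iterate_derivative_eq {Q : ℝ[X]} (hQ : ∀ u ∈ Icc (0 : ℝ) 1, 0 ≤ Q.eval u)
    (r : ℕ) : ∃ A : ℝ[X], A.natDegree ≤ Q.natDegree + r ∧
      (∀ j ≤ r, ∀ u ∈ Icc (0 : ℝ) 1, 0 ≤ (derivative^[j] A).eval u) ∧
      ∀ k, (k + r).factorial * integ ((1 - X) ^ k * A) =
        k.factorial * integ ((1 - X) ^ (k + r) * Q) := by
  induction r with
  | zero => exact ⟨Q, by simp, by simpa using hQ, by simp⟩
  | succ r ih =>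
    obtain ⟨A, hA1, hA2, hA3⟩ := ih
    obtain ⟨B, hB1, hB2, hB3⟩ := exists_derivative_eq A
    refine ⟨B, by omega, fun j hj => ?_, fun k => ?_⟩
    · cases j with
      | zero =>
        refine eval_nonneg_of_derivative hB2 ?_
        rw [Function.iterate_zero_apply, hB1]
        exact hA2 0 (by omega)
      | succ j =>
        rw [Function.iterate_succ_apply, hB1]
        exact hA2 j (by omega)
    · have h1 := integ_one_sub_pow_mul hB2 k
      have h2 := hA3 (k + 1)
      rw [← hB1, ← h1] at h2
      rw [show k + 1 + r = k + (r + 1) by ring, Nat.factorial_succ k] at h2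
      have h3 : (k : ℝ) + 1 ≠ 0 := by positivity
      refine mul_left_cancel₀ h3 ?_
      push_cast at h2
      linear_combination h2

theorem exists_fejer (m : ℕ) : ∃ H : ℝ[X], H.natDegree ≤ m - 1 ∧ ∀ u : ℝ,
    (1 - u) * H.eval u = (1 - (Chebyshev.T ℝ m).eval (2 * u - 1)) / 2 := by
  set R : ℝ[X] := C (1 / 2) * (1 - (Chebyshev.T ℝ m).comp (2 * X - 1)) with hR
  have h1 : R.IsRoot 1 := by
    simp [hR, IsRoot]
    norm_num
  obtain ⟨S, hS⟩ := dvd_iff_isRoot.2 h1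
  have hd : R.natDegree ≤ m := by
    refine (natDegree_C_mul_le _ _).trans ((natDegree_sub_le _ _).trans ?_)
    have : (2 * X - 1 : ℝ[X]).natDegree ≤ 1 := by compute_degree
    rw [natDegree_comp]
    simp only [natDegree_one, Chebyshev.natDegree_T]
    simpa using Nat.mul_le_mul_left m this
  refine ⟨-S, ?_, fun u => ?_⟩
  · rw [natDegree_neg]
    by_cases hS0 : S = 0
    · simp [hS0]
    · rw [hS, natDegree_mul (X_sub_C_ne_zero 1) hS0, natDegree_X_sub_C] at hd
      omega
  · have := congrArg (eval u) hS
    simp [hR] at this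
    simp
    linarith

theorem fejer_eval {m : ℕ} {H : ℝ[X]}
    (hH : ∀ u : ℝ, (1 - u) * H.eval u = (1 - (Chebyshev.T ℝ m).eval (2 * u - 1)) / 2)
    {u : ℝ} (hu : u ∈ Icc (0 : ℝ) 1) :
    (1 - u) * H.eval u = Real.sin (m * Real.arcsin (Real.sqrt (1 - u))) ^ 2 := by
  have h1 : Real.sin (Real.arcsin (Real.sqrt (1 - u))) = Real.sqrt (1 - u) :=
    Real.sin_arcsin (by linarith [Real.sqrt_nonneg (1 - u)])
      (Real.sqrt_le_one.2 (by linarith [hu.1]))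
  set θ := Real.arcsin (Real.sqrt (1 - u))
  have h2 : 2 * u - 1 = Real.cos (2 * θ) := by
    rw [Real.cos_two_mul, Real.cos_sq', h1, Real.sq_sqrt (sub_nonneg.2 hu.2)]
    ring
  rw [hH, h2, Chebyshev.T_real_cos, Int.cast_natCast, Real.sin_sq_eq_half_sub]
  rw [show (m : ℝ) * (2 * θ) = 2 * (m * θ) by ring]
  ring

theorem fejer_le_one {m : ℕ} {H : ℝ[X]}
    (hH : ∀ u : ℝ, (1 - u) * H.eval u = (1 - (Chebyshev.T ℝ m).eval (2 * u - 1)) / 2)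
    {u : ℝ} (hu : u ∈ Icc (0 : ℝ) 1) : (1 - u) * H.eval u ≤ 1 := by
  rw [fejer_eval hH hu]
  exact Real.sin_sq_le_one _

theorem fejer_nonneg {m : ℕ} {H : ℝ[X]}
    (hH : ∀ u : ℝ, (1 - u) * H.eval u = (1 - (Chebyshev.T ℝ m).eval (2 * u - 1)) / 2)
    {u : ℝ} (hu : u ∈ Icc (0 : ℝ) 1) : 0 ≤ (1 - u) * H.eval u := by
  rw [fejer_eval hH hu]
  positivity

theorem le_fejer {m : ℕ} {H : ℝ[X]}
    (hH : ∀ u : ℝ, (1 - u) * H.eval u = (1 - (Chebyshev.T ℝ m).eval (2 * u - 1)) / 2)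
    {u : ℝ} (hu : u ∈ Icc (0 : ℝ) 1) (hm : 1 ≤ m) (hum : 1 - u ≤ 1 / (m : ℝ) ^ 2) :
    (1 - u) * ((m : ℝ) ^ 2 / 4) ≤ (1 - u) * H.eval u := by
  rw [fejer_eval hH hu]
  have h0 : 0 ≤ 1 - u := sub_nonneg.2 hu.2
  have hm0 : (0 : ℝ) < m := by exact_mod_cast hm
  have hs1 : Real.sqrt (1 - u) ≤ 1 / m :=
    Real.sqrt_le_left (by positivity) |>.2 (by rwa [div_pow, one_pow])
  have h1 : Real.sin (Real.arcsin (Real.sqrt (1 - u))) = Real.sqrt (1 - u) :=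
    Real.sin_arcsin (by linarith [Real.sqrt_nonneg (1 - u)])
      (Real.sqrt_le_one.2 (by linarith [hu.1]))
  have hθ0 : 0 ≤ Real.arcsin (Real.sqrt (1 - u)) := Real.arcsin_nonneg.2 (Real.sqrt_nonneg _)
  have hθ1 := Real.arcsin_le_pi_div_two (Real.sqrt (1 - u))
  have hsq := Real.sq_sqrt h0
  set θ := Real.arcsin (Real.sqrt (1 - u))
  set s := Real.sqrt (1 - u)
  have hpi := Real.pi_pos
  have hpi4 := Real.pi_le_four
  have h2 : 2 / Real.pi * θ ≤ s := h1 ▸ Real.mul_le_sin hθ0 hθ1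
  have h3 : s ≤ θ := h1 ▸ Real.sin_le hθ0
  have h4 : m * θ ≤ Real.pi / 2 := by
    have : 2 / Real.pi * θ ≤ 1 / m := h2.trans hs1
    rw [div_mul_eq_mul_div, div_le_div_iff₀ hpi hm0] at this
    linarith
  have h5 := Real.mul_le_sin (by positivity : 0 ≤ m * θ) h4
  have h6 : 1 / 2 * (m * s) ≤ Real.sin (m * θ) := by
    refine le_trans ?_ h5
    refine mul_le_mul ?_ (mul_le_mul_of_nonneg_left h3 hm0.le) (by positivity) (by positivity)
    rw [div_le_div_iff₀ (by norm_num) hpi]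
    linarith
  have h7 := pow_le_pow_left₀ (by positivity) h6 2
  calc (1 - u) * ((m : ℝ) ^ 2 / 4) = (1 / 2 * (m * s)) ^ 2 := by rw [← hsq]; ring
    _ ≤ _ := h7

theorem integral_inv_sq {c : ℝ} (h0 : 0 ≤ c) (h1 : c < 1) :
    ∫ u in (0 : ℝ)..c, ((1 - u) ^ 2)⁻¹ = (1 - c)⁻¹ - 1 := by
  have hne : ∀ u ∈ uIcc 0 c, (1 - u) ≠ 0 := by
    intro u hu
    rw [Set.uIcc_of_le h0] at hu
    linarith [hu.2]
  have h : ∀ u ∈ uIcc 0 c, HasDerivAt (fun u : ℝ => (1 - u)⁻¹) (((1 - u) ^ 2)⁻¹) u := by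
    intro u hu
    have := ((hasDerivAt_id u).const_sub 1).inv (hne u hu)
    refine this.congr_deriv ?_
    simp
  rw [intervalIntegral.integral_eq_sub_of_hasDerivAt h]
  · simp
  · refine ContinuousOn.intervalIntegrable ?_
    exact ContinuousOn.inv₀ (by fun_prop) fun u hu => pow_ne_zero 2 (hne u hu)

theorem integral_one_sub_pow (c : ℝ) (r : ℕ) :
    ∫ u in c..1, (1 - u) ^ r = (1 - c) ^ (r + 1) / (r + 1) := by
  have h : ∀ u ∈ uIcc c 1, HasDerivAt (fun u : ℝ => -((1 - u) ^ (r + 1) / (r + 1)))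
      ((1 - u) ^ r) u := by
    intro u _
    have := ((((hasDerivAt_id u).const_sub 1).pow (r + 1)).div_const ((r : ℝ) + 1)).neg
    refine this.congr_deriv ?_
    have : (r : ℝ) + 1 ≠ 0 := by positivity
    push_cast
    simp
    field_simp
  rw [intervalIntegral.integral_eq_sub_of_hasDerivAt h
    (Continuous.intervalIntegrable (by fun_prop) _ _)]
  simp

theorem fejer_pow_moment {m : ℕ} {H : ℝ[X]}
    (hH : ∀ u : ℝ, (1 - u) * H.eval u = (1 - (Chebyshev.T ℝ m).eval (2 * u - 1)) / 2)
    (hm : 1 ≤ m) {r : ℕ} (hr : 1 ≤ r) :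
    0 < integ ((1 - X) ^ r * H ^ (2 * r + 2)) ∧
    (m : ℝ) ^ 2 * integ ((1 - X) ^ (r + 1) * H ^ (2 * r + 2)) ≤
      (1 + 4 ^ (2 * r + 2) * (r + 1)) * integ ((1 - X) ^ r * H ^ (2 * r + 2)) := by
  have hm1 : (1 : ℝ) ≤ m := by exact_mod_cast hm
  have hm0 : (0 : ℝ) < m := by linarith
  set δ : ℝ := 1 / (m : ℝ) ^ 2 with hδ
  have hδ0 : 0 < δ := by positivity
  have hδ1 : δ ≤ 1 := by
    rw [hδ, div_le_one (by positivity)]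
    nlinarith
  have hδm : (m : ℝ) ^ 2 * δ = 1 := by rw [hδ]; field_simp
  have hQ : ∀ (k : ℕ) (u : ℝ), u ≤ 1 → 0 ≤ (1 - u) ^ k * H.eval u ^ (2 * r + 2) := by
    intro k u hu
    refine mul_nonneg (pow_nonneg (sub_nonneg.2 hu) _) ?_
    rw [show 2 * r + 2 = 2 * (r + 1) by ring, pow_mul]
    positivity
  have hI : ∀ (k : ℕ) (a b : ℝ), IntervalIntegrable
      (fun u : ℝ => (1 - u) ^ k * H.eval u ^ (2 * r + 2)) MeasureTheory.volume a b :=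
    fun k a b => Continuous.intervalIntegrable (by fun_prop) _ _
  have hsplit : ∀ k : ℕ, integ ((1 - X) ^ k * H ^ (2 * r + 2)) =
      (∫ u in (0 : ℝ)..(1 - δ), (1 - u) ^ k * H.eval u ^ (2 * r + 2)) +
        ∫ u in (1 - δ)..1, (1 - u) ^ k * H.eval u ^ (2 * r + 2) := by
    intro k
    rw [intervalIntegral.integral_add_adjacent_intervals (hI k _ _) (hI k _ _), integ_apply]
    simp
  have hpos : 0 ≤ ∫ u in (0 : ℝ)..(1 - δ), (1 - u) ^ r * H.eval u ^ (2 * r + 2) :=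
    intervalIntegral.integral_nonneg (by linarith) fun u hu => hQ r u (by linarith [hu.2])
  have hlow : ((m : ℝ) ^ 2 / 4) ^ (2 * r + 2) * (δ ^ (r + 1) / (r + 1)) ≤
      ∫ u in (1 - δ)..1, (1 - u) ^ r * H.eval u ^ (2 * r + 2) := by
    have := integral_one_sub_pow (1 - δ) r
    rw [sub_sub_cancel] at this
    rw [← this, ← intervalIntegral.integral_const_mul]
    refine intervalIntegral.integral_mono_on (by linarith)
      (Continuous.intervalIntegrable (by fun_prop) _ _) (hI r _ _) fun u hu => ?_
    rcases eq_or_lt_of_le hu.2 with h | h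
    · rw [h, sub_self, zero_pow (by omega)]
      simp
    · have h1 := le_fejer hH ⟨by linarith [hu.1], hu.2⟩ hm (by linarith [hu.1])
      have h2 := le_of_mul_le_mul_left h1 (sub_pos.2 h)
      rw [mul_comm]
      exact mul_le_mul_of_nonneg_left (pow_le_pow_left₀ (by positivity) h2 _)
        (pow_nonneg (sub_nonneg.2 hu.2) _)
  have hlow' : (m : ℝ) ^ (2 * r + 2) ≤ 4 ^ (2 * r + 2) * (r + 1) *
      ∫ u in (1 - δ)..1, (1 - u) ^ r * H.eval u ^ (2 * r + 2) := by
    refine le_trans (le_of_eq ?_) (mul_le_mul_of_nonneg_left hlow (by positivity))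
    rw [hδ, div_pow, div_pow, one_pow, ← pow_mul, ← pow_mul,
      show 2 * (2 * r + 2) = (2 * r + 2) + 2 * (r + 1) by ring, pow_add _ (2 * r + 2)]
    field_simp
  have hnear : (∫ u in (1 - δ)..1, (1 - u) ^ (r + 1) * H.eval u ^ (2 * r + 2)) ≤
      δ * ∫ u in (1 - δ)..1, (1 - u) ^ r * H.eval u ^ (2 * r + 2) := by
    rw [← intervalIntegral.integral_const_mul]
    refine intervalIntegral.integral_mono_on (by linarith) (hI _ _ _) ((hI r _ _).const_mul _)
      fun u hu => ?_
    rw [pow_succ', mul_assoc]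
    exact mul_le_mul_of_nonneg_right (by linarith [hu.1]) (hQ r u hu.2)
  have hfar : (∫ u in (0 : ℝ)..(1 - δ), (1 - u) ^ (r + 1) * H.eval u ^ (2 * r + 2)) ≤
      (m : ℝ) ^ (2 * r) := by
    have h1 : (∫ u in (0 : ℝ)..(1 - δ), (1 - u) ^ (r + 1) * H.eval u ^ (2 * r + 2)) ≤
        ∫ u in (0 : ℝ)..(1 - δ), (m : ℝ) ^ (2 * (r - 1)) * ((1 - u) ^ 2)⁻¹ := by
      refine intervalIntegral.integral_mono_on (by linarith) (hI _ _ _) ?_ fun u hu => ?_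
      · refine ContinuousOn.intervalIntegrable (ContinuousOn.mul continuousOn_const
          (ContinuousOn.inv₀ (by fun_prop) fun u hu => pow_ne_zero 2 ?_))
        rw [Set.uIcc_of_le (by linarith)] at hu
        linarith [hu.2]
      · have hu1 : δ ≤ 1 - u := by linarith [hu.2]
        have hu0 : 0 < 1 - u := by linarith
        have hu' : u ∈ Icc (0 : ℝ) 1 := ⟨hu.1, by linarith⟩
        have h2 : ((1 - u) * H.eval u) ^ (2 * r + 2) ≤ 1 :=
          pow_le_one₀ (fejer_nonneg hH hu') (fejer_le_one hH hu')
        have h3 : 1 ≤ (m : ℝ) ^ (2 * (r - 1)) * (1 - u) ^ (r - 1) := by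
          rw [pow_mul, ← mul_pow]
          refine one_le_pow₀ ?_
          calc 1 = (m : ℝ) ^ 2 * δ := hδm.symm
            _ ≤ (m : ℝ) ^ 2 * (1 - u) := by gcongr
        rw [← div_eq_mul_inv, le_div_iff₀ (by positivity)]
        have h4 : (1 - u) ^ (r - 1) * ((1 - u) ^ (r + 1) * H.eval u ^ (2 * r + 2) * (1 - u) ^ 2) =
            ((1 - u) * H.eval u) ^ (2 * r + 2) := by
          rw [mul_pow, show (1 - u) ^ (2 * r + 2) = (1 - u) ^ (r - 1 + (r + 1) + 2) by
            congr 1; omega]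
          ring
        refine le_of_mul_le_mul_left ?_ (pow_pos hu0 (r - 1))
        rw [h4]
        linarith
    rw [intervalIntegral.integral_const_mul, integral_inv_sq (by linarith) (by linarith),
      sub_sub_cancel, show δ⁻¹ = (m : ℝ) ^ 2 by rw [hδ, one_div, inv_inv]] at h1
    refine h1.trans ?_
    rw [show 2 * r = 2 * (r - 1) + 2 by omega, pow_add]
    exact mul_le_mul_of_nonneg_left (by linarith) (by positivity)
  constructor
  · rw [hsplit]
    have : 0 < ((m : ℝ) ^ 2 / 4) ^ (2 * r + 2) * (δ ^ (r + 1) / (r + 1)) := by positivity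
    linarith
  · rw [hsplit, hsplit r]
    set J := ∫ u in (1 - δ)..1, (1 - u) ^ r * H.eval u ^ (2 * r + 2)
    set J0 := ∫ u in (0 : ℝ)..(1 - δ), (1 - u) ^ r * H.eval u ^ (2 * r + 2)
    have h1 := mul_le_mul_of_nonneg_left (add_le_add hfar hnear) (by positivity : 0 ≤ (m : ℝ) ^ 2)
    have h2 : (m : ℝ) ^ 2 * (m ^ (2 * r) + δ * J) = m ^ (2 * r + 2) + J := by
      linear_combination J * hδm
    have h3 : 0 ≤ (1 + 4 ^ (2 * r + 2) * ((r : ℝ) + 1)) * J0 := by positivity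
    linarith

theorem exists_weight {r : ℕ} (hr : 1 ≤ r) : ∃ C : ℝ, 0 ≤ C ∧ ∀ n : ℕ, 1 ≤ n → ∃ P : ℝ[X],
    P.natDegree ≤ n ∧ P.eval 0 = 0 ∧ P.eval 1 = 1 ∧
    (∀ j ≤ r + 1, ∀ u ∈ Icc (0 : ℝ) 1, 0 ≤ (derivative^[j] P).eval u) ∧
    (n : ℝ) ^ 2 * integ P ≤ C := by
  refine ⟨(2 * r + 2 + r + 1) ^ 2 * (1 + 4 ^ (2 * r + 2) * (r + 1)), by positivity, fun n hn => ?_⟩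
  rcases lt_or_ge n (r + 1) with hnr | hnr
  · refine ⟨X, by simpa using hn, by simp, by simp, fun j _ u hu => ?_, ?_⟩
    · rcases j with _ | _ | j
      · simpa using hu.1
      · simp
      · simp [iterate_derivative_X]
    · have h1 : integ X = 1 / 2 := by
        rw [integ_apply]
        simp
      have h2 : (n : ℝ) ^ 2 ≤ (2 * r + 2 + r + 1) ^ 2 := by
        have : (n : ℝ) ≤ r + 1 := by exact_mod_cast hnr.le
        refine pow_le_pow_left₀ (by positivity) ?_ 2
        linarith [(Nat.cast_nonneg r : (0 : ℝ) ≤ r)]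
      rw [h1]
      refine mul_le_mul h2 ?_ (by norm_num) (by positivity)
      have : (0 : ℝ) ≤ 4 ^ (2 * r + 2) * (r + 1) := by positivity
      linarith
  · set m := (n - (r + 1)) / (2 * r + 2) + 1 with hm
    have hm1 : 1 ≤ m := Nat.le_add_left _ _
    have hmn : (m - 1) * (2 * r + 2) + (r + 1) ≤ n := by
      have := Nat.div_mul_le_self (n - (r + 1)) (2 * r + 2)
      rw [hm, Nat.add_sub_cancel]
      omega
    have hnm : n ≤ m * (2 * r + 2 + r + 1) := by
      have h1 := Nat.lt_div_mul_add (a := n - (r + 1)) (show 0 < 2 * r + 2 by omega)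
      have h2 : m * (2 * r + 2) = (n - (r + 1)) / (2 * r + 2) * (2 * r + 2) + (2 * r + 2) := by
        rw [hm]; ring
      have h3 : r + 1 ≤ m * (r + 1) := Nat.le_mul_of_pos_left _ hm1
      have h4 : m * (2 * r + 2 + r + 1) = m * (2 * r + 2) + m * (r + 1) := by ring
      omega
    obtain ⟨H, hHd, hH⟩ := exists_fejer m
    obtain ⟨hpos, hle⟩ := fejer_pow_moment hH hm1 hr
    have hQ : ∀ u ∈ Icc (0 : ℝ) 1, 0 ≤ (H ^ (2 * r + 2)).eval u := by
      intro u _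
      rw [eval_pow, show 2 * r + 2 = 2 * (r + 1) by ring, pow_mul]
      positivity
    obtain ⟨B, hB1, hB2, hB3⟩ := exists_iterate_derivative_eq hQ r
    obtain ⟨A, hA1, hA2, hA3⟩ := exists_derivative_eq B
    have hI := hB3 0
    have hI' := hB3 1
    rw [← hA1, ← integ_one_sub_pow_mul hA2 0] at hI'
    simp only [zero_add, pow_zero, one_mul, Nat.factorial_zero, Nat.cast_one, Nat.factorial_one,
      Nat.cast_zero] at hI hI'
    rw [← hA1, integ_derivative, hA2, sub_zero] at hI
    rw [add_comm 1 r, Nat.factorial_succ] at hI'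
    set I := integ ((1 - X) ^ r * H ^ (2 * r + 2))
    set I' := integ ((1 - X) ^ (r + 1) * H ^ (2 * r + 2))
    have hf : (0 : ℝ) < r.factorial := by positivity
    have hA1pos : 0 < A.eval 1 := by
      refine pos_of_mul_pos_right ?_ hf.le
      rw [hI]
      exact hpos
    have hAnn : ∀ j ≤ r + 1, ∀ u ∈ Icc (0 : ℝ) 1, 0 ≤ (derivative^[j] A).eval u := by
      intro j hj
      cases j with
      | zero =>
        refine eval_nonneg_of_derivative hA2 ?_
        rw [Function.iterate_zero_apply, hA1]
        exact hB2 0 (by omega)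
      | succ j =>
        rw [Function.iterate_succ_apply, hA1]
        exact hB2 j (by omega)
    refine ⟨(A.eval 1)⁻¹ • A, ?_, by simp [hA2], by simp [hA1pos.ne'], fun j hj u hu => ?_, ?_⟩
    · refine (natDegree_smul_le _ _).trans ?_
      have h1 : (H ^ (2 * r + 2)).natDegree ≤ (m - 1) * (2 * r + 2) :=
        natDegree_pow_le.trans (by rw [mul_comm]; exact Nat.mul_le_mul_right _ hHd)
      omega
    · rw [iterate_derivative_smul, eval_smul, smul_eq_mul]
      exact mul_nonneg (inv_nonneg.2 hA1pos.le) (hAnn j hj u hu)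
    · rw [map_smul, smul_eq_mul]
      have hA0 : 0 ≤ integ A := integ_nonneg (hAnn 0 (by omega))
      have h1 : (m : ℝ) ^ 2 * integ A ≤ (1 + 4 ^ (2 * r + 2) * (r + 1)) * A.eval 1 := by
        rw [← hI, ← hI'] at hle
        push_cast at hle
        refine le_of_mul_le_mul_left ?_ hf
        have : (r.factorial : ℝ) * (m ^ 2 * integ A) ≤
            (r + 1) * r.factorial * (m ^ 2 * integ A) := by
          have : 0 ≤ (r : ℝ) * r.factorial * (m ^ 2 * integ A) := by positivity
          linarith
        linarith
      have h2 : (n : ℝ) ^ 2 ≤ m ^ 2 * (2 * r + 2 + r + 1) ^ 2 := by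
        rw [← mul_pow]
        exact pow_le_pow_left₀ (by positivity) (by exact_mod_cast hnm) 2
      rw [← mul_assoc, mul_comm _ (A.eval 1)⁻¹, mul_assoc, inv_mul_le_iff₀ hA1pos]
      calc (n : ℝ) ^ 2 * integ A ≤ m ^ 2 * (2 * r + 2 + r + 1) ^ 2 * integ A := by gcongr
        _ = (2 * r + 2 + r + 1) ^ 2 * (m ^ 2 * integ A) := by ring
        _ ≤ (2 * r + 2 + r + 1) ^ 2 * ((1 + 4 ^ (2 * r + 2) * (r + 1)) * A.eval 1) := by gcongr
        _ = _ := by ring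

/-! ### Quadratic minorants from a bound on second differences -/

theorem two_mul_le_log_sub_log {z : ℝ} (h0 : 0 ≤ z) (h1 : z < 1) :
    2 * z ≤ Real.log (1 + z) - Real.log (1 - z) := by
  have h2 : 0 < 1 - z := sub_pos.2 h1
  have h := Real.le_log_one_add_of_nonneg (show 0 ≤ 2 * z / (1 - z) by positivity)
  have e1 : 2 * (2 * z / (1 - z)) / (2 * z / (1 - z) + 2) = 2 * z := by
    field_simp
    ring
  have e2 : 1 + 2 * z / (1 - z) = (1 + z) / (1 - z) := by
    field_simp
    ring
  rwa [e1, e2, Real.log_div (by positivity) h2.ne'] at h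

theorem sq_le_mul_log_add_mul_log {z : ℝ} (hz : z ∈ Icc (0 : ℝ) 1) :
    z ^ 2 ≤ (1 + z) * Real.log (1 + z) + (1 - z) * Real.log (1 - z) := by
  set F : ℝ → ℝ := fun z => (1 + z) * Real.log (1 + z) + (1 - z) * Real.log (1 - z) - z ^ 2
  have hc : Continuous F :=
    ((Real.continuous_mul_log.comp (by fun_prop : Continuous fun z : ℝ => 1 + z)).add
      (Real.continuous_mul_log.comp (by fun_prop : Continuous fun z : ℝ => 1 - z))).sub
        (continuous_pow 2)
  have hd : ∀ x ∈ Ioo (0 : ℝ) 1,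
      HasDerivAt F (Real.log (1 + x) - Real.log (1 - x) - 2 * x) x := by
    intro x hx
    have h1 := (Real.hasDerivAt_mul_log (show 1 + x ≠ 0 by linarith [hx.1])).comp x
      ((hasDerivAt_id x).const_add 1)
    have h2 := (Real.hasDerivAt_mul_log (show 1 - x ≠ 0 by linarith [hx.2])).comp x
      ((hasDerivAt_id x).const_sub 1)
    refine ((h1.add h2).sub (hasDerivAt_pow 2 x)).congr_deriv ?_
    simp
    ring
  have hm : MonotoneOn F (Icc 0 1) := by
    refine monotoneOn_of_deriv_nonneg (convex_Icc 0 1) hc.continuousOn ?_ ?_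
    · rw [interior_Icc]
      exact fun x hx => (hd x hx).differentiableAt.differentiableWithinAt
    · rw [interior_Icc]
      intro x hx
      rw [(hd x hx).deriv]
      linarith [two_mul_le_log_sub_log hx.1.le hx.2]
  have := hm (by simp) hz hz.1
  simp only [F] at this
  simp at this
  linarith

theorem div_le_second_difference_mul_log {y h : ℝ} (h0 : 0 < h) (hy : h ≤ y) :
    h ^ 2 / y ≤ (y - h) * Real.log (y - h) - 2 * (y * Real.log y) +
      (y + h) * Real.log (y + h) := by
  have hy0 : 0 < y := h0.trans_le hy
  have hz : h / y ∈ Icc (0 : ℝ) 1 := ⟨by positivity, (div_le_one hy0).2 hy⟩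
  have h1 := mul_le_mul_of_nonneg_left (sq_le_mul_log_add_mul_log hz) hy0.le
  have e1 : y + h = y * (1 + h / y) := by field_simp
  have e2 : y - h = y * (1 - h / y) := by field_simp
  have l1 : (y + h) * Real.log (y + h) =
      y * (1 + h / y) * Real.log y + y * ((1 + h / y) * Real.log (1 + h / y)) := by
    rw [e1, Real.log_mul hy0.ne' (by positivity)]
    ring
  have l2 : (y - h) * Real.log (y - h) =
      y * (1 - h / y) * Real.log y + y * ((1 - h / y) * Real.log (1 - h / y)) := by
    rw [e2]
    rcases eq_or_ne (1 - h / y) 0 with h3 | h3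
    · simp [h3]
    · rw [Real.log_mul hy0.ne' h3]
      ring
  rw [l1, l2]
  have e3 : h ^ 2 / y = y * (h / y) ^ 2 := by field_simp
  rw [e3]
  linarith

/-- The negative binary entropy. -/
def ent (t : ℝ) : ℝ := t * Real.log t + (1 - t) * Real.log (1 - t)

theorem continuous_ent : Continuous ent :=
  Real.continuous_mul_log.add
    (Real.continuous_mul_log.comp (by fun_prop : Continuous fun z : ℝ => 1 - z))

theorem le_second_difference_ent {y h : ℝ} (h0 : 0 < h) (h1 : 0 ≤ y - h) (h2 : y + h ≤ 1) :
    h ^ 2 / (y * (1 - y)) ≤ ent (y - h) - 2 * ent y + ent (y + h) := by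
  have a1 := div_le_second_difference_mul_log h0 (sub_nonneg.1 h1)
  have a2 := div_le_second_difference_mul_log h0 (show h ≤ 1 - y by linarith)
  have hy : 0 < y := by linarith
  have hy1 : 0 < 1 - y := by linarith
  have e : h ^ 2 / (y * (1 - y)) = h ^ 2 / y + h ^ 2 / (1 - y) := by
    field_simp
    ring
  rw [e]
  simp only [ent]
  rw [show 1 - (y - h) = 1 - y + h by ring, show 1 - (y + h) = 1 - y - h by ring]
  linarith

theorem ent_le {x t : ℝ} (hx : x ∈ Ioo (0 : ℝ) 1) (ht : t ∈ Icc (0 : ℝ) 1) :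
    ent t ≤ ent x + (Real.log x - Real.log (1 - x)) * (t - x) +
      (t - x) ^ 2 / (x * (1 - x)) := by
  have key : ∀ {s y : ℝ}, 0 < y → 0 ≤ s →
      s * Real.log s ≤ s * Real.log y + s * (s / y - 1) := by
    intro s y hy hs
    rcases eq_or_lt_of_le hs with rfl | hs
    · simp
    · have := Real.log_le_sub_one_of_pos (div_pos hs hy)
      rw [Real.log_div hs.ne' hy.ne'] at this
      rw [← mul_add]
      exact mul_le_mul_of_nonneg_left (by linarith) hs.le
  have h1 := key hx.1 ht.1
  have h2 := key (sub_pos.2 hx.2) (sub_nonneg.2 ht.2)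
  have hx0 := hx.1.ne'
  have hx1 := (sub_pos.2 hx.2).ne'
  have e : (t - x) ^ 2 / (x * (1 - x)) =
      t * (t / x - 1) + (1 - t) * ((1 - t) / (1 - x) - 1) := by
    field_simp
    ring
  rw [e]
  simp only [ent]
  linarith

/-- The steps allowed by the weighted second modulus at scale `τ` change `g` by at most `w`. -/
def SecondDiffLe (g : ℝ → ℝ) (τ w : ℝ) : Prop :=
  ∀ y h : ℝ, 0 < h → h ≤ τ * phi y → 0 ≤ y - h → y + h ≤ 1 →
    |g (y - h) - 2 * g y + g (y + h)| ≤ w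

theorem SecondDiffLe.neg {g : ℝ → ℝ} {τ w : ℝ} (h : SecondDiffLe g τ w) :
    SecondDiffLe (fun t => -g t) τ w := by
  intro y k h0 h1 h2 h3
  rw [← abs_neg]
  refine le_of_eq_of_le ?_ (h y k h0 h1 h2 h3)
  congr 1
  ring

theorem chord_bound {g : ℝ → ℝ} {τ w : ℝ} (hg : ContinuousOn g (Icc 0 1)) (hτ : 0 < τ)
    (hw : 0 < w) (h : SecondDiffLe g τ w) {u x v : ℝ} (hu : 0 ≤ u) (hux : u < x) (hxv : x < v)
    (hv : v ≤ 1) :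
    (v - u) * (g x + 2 * w / τ ^ 2 * ent x - w) ≤
      (g u + 2 * w / τ ^ 2 * ent u) * (v - x) + (g v + 2 * w / τ ^ 2 * ent v) * (x - u) := by
  have huv : 0 < v - u := by linarith
  set κ := 2 * w / τ ^ 2 with hκ
  have hκ0 : 0 < κ := by positivity
  set F : ℝ → ℝ := fun t => g t + κ * ent t with hF
  set G : ℝ → ℝ := fun t => F t - (F u + (F v - F u) / (v - u) * (t - u)) with hG
  have hGu : G u = 0 := by simp [hG]
  have hGv : G v = 0 := by
    simp only [hG]
    field_simp
    ring
  have hGc : ContinuousOn G (Icc u v) := by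
    refine ContinuousOn.sub (ContinuousOn.add (hg.mono (Icc_subset_Icc hu hv))
      (continuousOn_const.mul continuous_ent.continuousOn)) ?_
    fun_prop
  obtain ⟨y, hy, hmax⟩ := isCompact_Icc.exists_isMaxOn (nonempty_Icc.2 (by linarith)) hGc
  have hmax' : ∀ t ∈ Icc u v, G t ≤ G y := fun t ht => hmax ht
  have hGy : G y ≤ w := by
    rcases eq_or_lt_of_le hy.1 with h1 | h1
    · rw [← h1, hGu]; exact hw.le
    rcases eq_or_lt_of_le hy.2 with h2 | h2
    · rw [h2, hGv]; exact hw.le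
    have hy0 : 0 < y := by linarith
    have hy1 : 0 < 1 - y := by linarith
    have hφ : 0 < phi y := Real.sqrt_pos.2 (mul_pos hy0 hy1)
    set k := min (τ * phi y) (min (y - u) (v - y)) with hk
    have hk0 : 0 < k := by
      rw [hk]
      exact lt_min (mul_pos hτ hφ) (lt_min (by linarith) (by linarith))
    have hk1 : k ≤ τ * phi y := min_le_left _ _
    have hk2 : k ≤ y - u := (min_le_right _ _).trans (min_le_left _ _)
    have hk3 : k ≤ v - y := (min_le_right _ _).trans (min_le_right _ _)
    have hm1 := hmax' (y - k) ⟨by linarith, by linarith⟩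
    have hm2 := hmax' (y + k) ⟨by linarith, by linarith⟩
    have hdiff : G (y - k) - 2 * G y + G (y + k) = (g (y - k) - 2 * g y + g (y + k)) +
        κ * (ent (y - k) - 2 * ent y + ent (y + k)) := by
      simp only [hG, hF]
      ring
    have hg2 := (abs_le.1 (h y k hk0 hk1 (by linarith) (by linarith))).1
    have hent := mul_le_mul_of_nonneg_left
      (le_second_difference_ent hk0 (show 0 ≤ y - k by linarith) (by linarith)) hκ0.le
    have hnn : 0 ≤ κ * (k ^ 2 / (y * (1 - y))) := by positivity
    rcases le_total (τ * phi y) (min (y - u) (v - y)) with hc | hc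
    · rw [min_eq_left hc] at hk
      have : κ * (k ^ 2 / (y * (1 - y))) = 2 * w := by
        rw [hk, mul_pow, phi, Real.sq_sqrt (by positivity), hκ]
        field_simp
      linarith
    · rw [min_eq_right hc] at hk
      rcases le_total (y - u) (v - y) with hc2 | hc2
      · rw [min_eq_left hc2] at hk
        have hz : G (y - k) = 0 := by rw [hk, sub_sub_cancel, hGu]
        linarith
      · rw [min_eq_right hc2] at hk
        have hz : G (y + k) = 0 := by rw [hk, add_sub_cancel, hGv]
        linarith
  have hx := (hmax' x ⟨hux.le, hxv.le⟩).trans hGy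
  simp only [hG] at hx
  have h2 := mul_le_mul_of_nonneg_left hx huv.le
  have e : (v - u) * (F x - (F u + (F v - F u) / (v - u) * (x - u))) =
      (v - u) * F x - (F u * (v - x) + F v * (x - u)) := by
    field_simp
    ring
  rw [e] at h2
  change (v - u) * (F x - w) ≤ F u * (v - x) + F v * (x - u)
  linarith

theorem exists_slope {F : ℝ → ℝ} {w x : ℝ} (hw : 0 ≤ w) (hx : x ∈ Ioo (0 : ℝ) 1)
    (h : ∀ u v, 0 ≤ u → u < x → x < v → v ≤ 1 →
      (v - u) * (F x - w) ≤ F u * (v - x) + F v * (x - u)) :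
    ∃ a, ∀ t ∈ Icc (0 : ℝ) 1, F x - w + a * (t - x) ≤ F t := by
  set S : Set ℝ := (fun u => (F x - w - F u) / (x - u)) '' Ico 0 x with hS
  have hub : ∀ v, x < v → v ≤ 1 → ∀ s ∈ S, s ≤ (F v - F x + w) / (v - x) := by
    rintro v hv hv1 _ ⟨u, hu, rfl⟩
    rw [div_le_div_iff₀ (sub_pos.2 hu.2) (sub_pos.2 hv)]
    have := h u v hu.1 hu.2 hv hv1
    linarith
  refine ⟨sSup S, fun t ht => ?_⟩
  rcases lt_trichotomy t x with htx | rfl | htx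
  · have h1 : (F x - w - F t) / (x - t) ≤ sSup S :=
      le_csSup ⟨_, fun s hs => hub 1 hx.2 le_rfl s hs⟩ ⟨t, ⟨ht.1, htx⟩, rfl⟩
    rw [div_le_iff₀ (sub_pos.2 htx)] at h1
    linarith
  · simpa using hw
  · have h1 : sSup S ≤ (F t - F x + w) / (t - x) :=
      csSup_le ⟨_, 0, ⟨le_rfl, hx.1⟩, rfl⟩ (hub t htx ht.2)
    rw [le_div_iff₀ (sub_pos.2 htx)] at h1
    linarith

theorem exists_quadratic_minorant {g : ℝ → ℝ} {τ w : ℝ} (hg : ContinuousOn g (Icc 0 1))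
    (hτ : 0 < τ) (hw : 0 < w) (h : SecondDiffLe g τ w) {x : ℝ} (hx : x ∈ Ioo (0 : ℝ) 1) :
    ∃ a, ∀ t ∈ Icc (0 : ℝ) 1,
      g x + a * (t - x) - w - 2 * w / τ ^ 2 / (x * (1 - x)) * (t - x) ^ 2 ≤ g t := by
  obtain ⟨a, ha⟩ := exists_slope (F := fun t => g t + 2 * w / τ ^ 2 * ent t) hw.le hx
    fun u v hu hux hxv hv => chord_bound hg hτ hw h hu hux hxv hv
  refine ⟨a - 2 * w / τ ^ 2 * (Real.log x - Real.log (1 - x)), fun t ht => ?_⟩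
  have h1 := ha t ht
  have h2 := mul_le_mul_of_nonneg_left (ent_le hx ht) (by positivity : 0 ≤ 2 * w / τ ^ 2)
  have e : 2 * w / τ ^ 2 / (x * (1 - x)) * (t - x) ^ 2 =
      2 * w / τ ^ 2 * ((t - x) ^ 2 / (x * (1 - x))) := by ring
  rw [e]
  linarith

/-! ### The error of approximation by mixtures of Durrmeyer operators -/

theorem le_conv_eval {P : ℝ[X]} (h0 : P.eval 0 = 0) (h1 : P.eval 1 = 1)
    (hP : ∀ u ∈ Icc (0 : ℝ) 1, 0 ≤ P.eval u)
    (hd : ∀ u ∈ Icc (0 : ℝ) 1, 0 ≤ (derivative^[2] P).eval u) {g : ℝ[X]} {τ w : ℝ}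
    (hτ : 0 < τ) (hw : 0 < w) (h : SecondDiffLe (fun t => g.eval t) τ w) {x : ℝ}
    (hx : x ∈ Ioo (0 : ℝ) 1) :
    g.eval x - w * (1 + 4 * integ P / τ ^ 2) ≤ (conv P g).eval x := by
  obtain ⟨a, ha⟩ := exists_quadratic_minorant g.continuous.continuousOn hτ hw h hx
  set b := 2 * w / τ ^ 2 / (x * (1 - x)) with hb
  have hx' : x ∈ Icc (0 : ℝ) 1 := ⟨hx.1.le, hx.2.le⟩
  have := eval_conv_nonneg h0 hP hd
    (f := g - (g.eval x - a * x - w - b * x ^ 2) • 1 - (a + 2 * b * x) • X + b • X ^ 2)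
    (fun t ht => ?_) hx'
  · rw [map_add, map_sub, map_sub, map_smul, map_smul, map_smul, conv_one h0 h1, conv_X h0 h1,
      eval_add, eval_sub, eval_sub, eval_smul, eval_smul, eval_smul, conv_X_sq_eval h0 h1] at this
    simp only [eval_one, eval_X, smul_eq_mul] at this
    have e : b * (2 * integ P * (x * (1 - x))) = w * (4 * integ P / τ ^ 2) := by
      have := hx.1.ne'
      have := (sub_pos.2 hx.2).ne'
      rw [hb]
      field_simp
      ring
    linarith
  · have := ha t ht
    simp only [eval_add, eval_sub, eval_smul, eval_one, eval_X, eval_pow, smul_eq_mul]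
    linarith

theorem abs_conv_eval_sub_le {P : ℝ[X]} (h0 : P.eval 0 = 0) (h1 : P.eval 1 = 1)
    (hP : ∀ u ∈ Icc (0 : ℝ) 1, 0 ≤ P.eval u)
    (hd : ∀ u ∈ Icc (0 : ℝ) 1, 0 ≤ (derivative^[2] P).eval u) {g : ℝ[X]} {τ w : ℝ}
    (hτ : 0 < τ) (hw : 0 < w) (h : SecondDiffLe (fun t => g.eval t) τ w) {x : ℝ}
    (hx : x ∈ Icc (0 : ℝ) 1) :
    |g.eval x - (conv P g).eval x| ≤ w * (1 + 4 * integ P / τ ^ 2) := by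
  have hi : 0 ≤ integ P := integ_nonneg hP
  rcases eq_or_lt_of_le hx.1 with rfl | hx0
  · rw [conv_eval_zero h0 h1, sub_self, abs_zero]
    positivity
  rcases eq_or_lt_of_le hx.2 with rfl | hx1
  · rw [conv_eval_one h0 h1, sub_self, abs_zero]
    positivity
  have a1 := le_conv_eval h0 h1 hP hd hτ hw h ⟨hx0, hx1⟩
  have a2 := le_conv_eval h0 h1 hP hd (g := -g) hτ hw (by simpa using h.neg) ⟨hx0, hx1⟩
  rw [map_neg, eval_neg, eval_neg] at a2
  rw [abs_le]
  constructor <;> linarith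

/-! ### Second differences and the modulus of smoothness -/

theorem centralDiff_two {f : ℝ → ℝ} {y h : ℝ} (h1 : y - h ∈ I01) (h2 : y + h ∈ I01) :
    centralDiff 2 h f y = f (y - h) - 2 * f y + f (y + h) := by
  have e1 : y - (2 : ℕ) * h / 2 = y - h := by push_cast; ring
  have e2 : y + (2 : ℕ) * h / 2 = y + h := by push_cast; ring
  rw [centralDiff, e1, e2, if_pos ⟨h1, h2⟩]
  simp only [Finset.sum_range_succ, Finset.sum_range_zero]
  norm_num
  rw [show y - h + 2 * h = y + h by ring]
  ring

theorem bddAbove_omega2_set {ψ f : ℝ → ℝ} (hf : ContinuousOn f I01) (t : ℝ) :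
    BddAbove {v : ℝ | ∃ s x : ℝ, 0 < s ∧ s ≤ t ∧ x ∈ I01 ∧ v = |centralDiff 2 (s * ψ x) f x|} := by
  obtain ⟨M, hM⟩ := isCompact_Icc.exists_bound_of_continuousOn hf
  simp only [Real.norm_eq_abs] at hM
  refine ⟨4 * M, ?_⟩
  rintro _ ⟨s, x, -, -, hx, rfl⟩
  have h0 := hM x hx
  by_cases h : x - s * ψ x ∈ I01 ∧ x + s * ψ x ∈ I01
  · rw [centralDiff_two h.1 h.2]
    have h1 := abs_le.1 (hM _ h.1)
    have h2 := abs_le.1 (hM _ h.2)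
    have h3 := abs_le.1 h0
    rw [abs_le]
    constructor <;> linarith
  · have : centralDiff 2 (s * ψ x) f x = 0 := by
      rw [centralDiff, if_neg]
      push_cast
      rwa [mul_div_cancel_left₀ _ (two_ne_zero)]
    rw [this, abs_zero]
    linarith [abs_nonneg (f x)]

theorem omega2_nonneg (ψ f : ℝ → ℝ) (t : ℝ) : 0 ≤ omega2 ψ f t := by
  refine Real.sSup_nonneg ?_
  rintro _ ⟨s, x, -, -, -, rfl⟩
  exact abs_nonneg _

theorem secondDiffLe_omega2 {f : ℝ → ℝ} (hf : ContinuousOn f I01) (τ : ℝ) :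
    SecondDiffLe f τ (omega2 phi f τ) := by
  intro y h h0 h1 h2 h3
  have hy : 0 < phi y := by
    refine Real.sqrt_pos.2 (mul_pos ?_ ?_) <;> linarith
  have e : h / phi y * phi y = h := div_mul_cancel₀ _ hy.ne'
  rw [← centralDiff_two (f := f) ⟨h2, by linarith⟩ ⟨by linarith, h3⟩]
  refine le_csSup (bddAbove_omega2_set hf τ)
    ⟨h / phi y, y, by positivity, (div_le_iff₀ hy).2 h1, ⟨by linarith, by linarith⟩, ?_⟩
  rw [e]

theorem SecondDiffLe.of_abs_sub_le {f g : ℝ → ℝ} {τ w ε : ℝ} (h : SecondDiffLe f τ w)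
    (hfg : ∀ x ∈ I01, |f x - g x| ≤ ε) : SecondDiffLe g τ (w + 4 * ε) := by
  intro y k h0 h1 h2 h3
  have a := abs_le.1 (h y k h0 h1 h2 h3)
  have b1 := abs_le.1 (hfg (y - k) ⟨h2, by linarith⟩)
  have b2 := abs_le.1 (hfg y ⟨by linarith, by linarith⟩)
  have b3 := abs_le.1 (hfg (y + k) ⟨by linarith, h3⟩)
  rw [abs_le]
  constructor <;> linarith

/-! ### Higher order monotonicity of polynomials -/

theorem centralDiff_eq_fwdDiff {q : ℕ} {δ x : ℝ} (f : ℝ → ℝ) (h1 : x - q * δ / 2 ∈ I01)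
    (h2 : x + q * δ / 2 ∈ I01) :
    centralDiff q δ f x = (fwdDiff δ)^[q] f (x - q * δ / 2) := by
  rw [centralDiff, if_pos ⟨h1, h2⟩, fwdDiff_iter_eq_sum_shift]
  refine Finset.sum_congr rfl fun i _ => ?_
  rw [zsmul_eq_mul, nsmul_eq_mul]
  push_cast
  ring

theorem fwdDiff_iterate_eval_nonneg {h : ℝ} (hh : 0 ≤ h) (q : ℕ) {a b : ℝ} {p : ℝ[X]}
    (hp : ∀ u ∈ Icc a b, 0 ≤ (derivative^[q] p).eval u) {y : ℝ} (hy : a ≤ y)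
    (hy' : y + q * h ≤ b) : 0 ≤ (fwdDiff h)^[q] (fun t => p.eval t) y := by
  induction q generalizing p b with
  | zero => exact hp y ⟨hy, by simpa using hy'⟩
  | succ q ih =>
    have e : fwdDiff h (fun t => p.eval t) = fun t => (p.comp (X + C h) - p).eval t := by
      ext t
      simp [fwdDiff]
    have hd : ∀ k, derivative^[k] (p.comp (X + C h)) = (derivative^[k] p).comp (X + C h) := by
      intro k
      induction k with
      | zero => rfl
      | succ k ihk =>
        rw [Function.iterate_succ_apply', ihk, Function.iterate_succ_apply', derivative_comp]
        simp
    have hm : MonotoneOn (fun u => (derivative^[q] p).eval u) (Icc a b) := by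
      refine monotoneOn_of_deriv_nonneg (convex_Icc a b) (Polynomial.continuous _).continuousOn
        (Polynomial.differentiable _).differentiableOn fun u hu => ?_
      rw [Polynomial.deriv]
      have := hp u (interior_subset hu)
      rwa [Function.iterate_succ_apply'] at this
    rw [Function.iterate_succ_apply, e]
    refine ih (b := b - h) (fun u hu => ?_) (by push_cast at hy'; linarith)
    rw [iterate_derivative_sub, hd, eval_sub, eval_comp, sub_nonneg]
    simp only [eval_add, eval_X, eval_C]
    exact hm ⟨hu.1, by linarith [hu.2]⟩ ⟨by linarith [hu.1], by linarith [hu.2]⟩ (by linarith)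

theorem kMono_eval {q : ℕ} {p : ℝ[X]}
    (hp : ∀ u ∈ Icc (0 : ℝ) 1, 0 ≤ (derivative^[q] p).eval u) :
    kMono q (fun x => p.eval x) := by
  intro δ hδ x _
  by_cases h : x - q * δ / 2 ∈ I01 ∧ x + q * δ / 2 ∈ I01
  · rw [centralDiff_eq_fwdDiff _ h.1 h.2]
    exact fwdDiff_iterate_eval_nonneg hδ.le q hp h.1.1 (by linarith [h.2.2])
  · rw [centralDiff, if_neg h]

/-! ### Bernstein approximation of functions with higher order monotonicity -/

theorem eval_iterate_derivative_sum_bernstein_nonneg (q m : ℕ) {c : ℕ → ℝ}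
    (hc : ∀ j ≤ m, 0 ≤ (fwdDiff 1)^[q] c j) {u : ℝ} (hu : u ∈ Icc (0 : ℝ) 1) :
    0 ≤ (derivative^[q] (∑ k ∈ Finset.range (m + q + 1),
      c k • bernsteinPolynomial ℝ (m + q) k)).eval u := by
  induction q generalizing c with
  | zero =>
    rw [Function.iterate_zero_apply, eval_finsetSum]
    refine Finset.sum_nonneg fun k hk => ?_
    rw [eval_smul, smul_eq_mul]
    rw [Finset.mem_range] at hk
    exact mul_nonneg (hc k (by omega)) (bernstein_eval_nonneg _ _ hu)
  | succ q ih =>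
    rw [Function.iterate_succ_apply, ← add_assoc, derivative_sum_bernstein,
      iterate_derivative_smul, eval_smul, smul_eq_mul]
    exact mul_nonneg (by positivity) (ih (c := fwdDiff 1 c) hc)

theorem exists_polynomial_near {q : ℕ} {f : ℝ → ℝ} (hf : ContinuousOn f I01) (hq : kMono q f)
    {ε : ℝ} (hε : 0 < ε) : ∃ g : ℝ[X], (∀ x ∈ I01, |f x - g.eval x| ≤ ε) ∧
      ∀ u ∈ Icc (0 : ℝ) 1, 0 ≤ (derivative^[q] g).eval u := by
  set F : C(unitInterval, ℝ) := ⟨fun x => f x, continuousOn_iff_continuous_domRestrict.1 hf⟩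
  obtain ⟨N, hN⟩ := Metric.tendsto_atTop.1 (bernsteinApproximation_uniform F) ε hε
  set M := N + 1 + q with hM
  have hM0 : (0 : ℝ) < M := by
    rw [hM]
    push_cast
    positivity
  refine ⟨∑ k ∈ Finset.range (N + 1 + q + 1), f (k / M) • bernsteinPolynomial ℝ (N + 1 + q) k,
    fun x hx => ?_, fun u hu => ?_⟩
  · have h1 := (ContinuousMap.dist_apply_le_dist ⟨x, hx⟩).trans (hN M (by omega)).le
    rw [dist_comm, Real.dist_eq, bernsteinApproximation.apply] at h1
    rw [eval_finsetSum, Finset.sum_range]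
    refine le_of_eq_of_le ?_ h1
    congr 2
    refine Finset.sum_congr rfl fun k _ => ?_
    rw [eval_smul, bernstein_eval, bernstein_apply, smul_eq_mul, smul_eq_mul, mul_comm]
    rfl
  · refine eval_iterate_derivative_sum_bernstein_nonneg q (N + 1) (fun j hj => ?_) hu
    have hjM : (j : ℝ) / M + q / M ≤ 1 := by
      rw [← add_div, div_le_one hM0]
      exact_mod_cast (by omega : j + q ≤ M)
    have hj0 : (0 : ℝ) ≤ j / M := by positivity
    have hq0 : (0 : ℝ) ≤ q / M := by positivity
    have e1 : (j : ℝ) / M + q / M / 2 - q * (1 / M) / 2 = j / M := by ring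
    have e2 : (j : ℝ) / M + q / M / 2 + q * (1 / M) / 2 = j / M + q / M := by ring
    have h1 := hq (1 / M) (by positivity) (j / M + q / M / 2) ⟨by linarith, by linarith⟩
    rw [centralDiff_eq_fwdDiff, e1] at h1
    · rw [fwdDiff_iter_eq_sum_shift] at h1 ⊢
      refine le_of_le_of_eq h1 (Finset.sum_congr rfl fun i _ => ?_)
      congr 2
      simp
      ring
    · rw [e1]
      exact ⟨hj0, by linarith⟩
    · rw [e2]
      exact ⟨by linarith, hjM⟩

/-! ### The degree of approximation -/

theorem bestQMonoApprox_le {q n : ℕ} {f : ℝ → ℝ} {p : ℝ[X]} (hp : p.natDegree ≤ n)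
    (hq : kMono q fun x => p.eval x) {B : ℝ} (hB : ∀ x ∈ I01, |f x - p.eval x| ≤ B) :
    bestQMonoApprox q n f ≤ B := by
  have hbdd : BddBelow {v : ℝ | ∃ p : ℝ[X], p.natDegree ≤ n ∧
      kMono q (fun x => p.eval x) ∧ v = supNormI (fun x => f x - p.eval x)} := by
    refine ⟨0, ?_⟩
    rintro _ ⟨p, -, -, rfl⟩
    refine Real.sSup_nonneg ?_
    rintro _ ⟨x, -, rfl⟩
    exact abs_nonneg _
  refine (csInf_le hbdd ⟨p, hp, hq, rfl⟩).trans (csSup_le ⟨_, 0, by simp [I01], rfl⟩ ?_)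
  rintro _ ⟨x, hx, rfl⟩
  exact hB x hx

theorem bestQMonoApprox_le_omega2 {q n : ℕ} (hn : 1 ≤ n) {P : ℝ[X]} (hPn : P.natDegree ≤ n)
    (h0 : P.eval 0 = 0) (h1 : P.eval 1 = 1)
    (hd : ∀ j ≤ max q 2, ∀ u ∈ Icc (0 : ℝ) 1, 0 ≤ (derivative^[j] P).eval u) {C : ℝ}
    (hC : (n : ℝ) ^ 2 * integ P ≤ C) {f : ℝ → ℝ} (hf : ContinuousOn f I01) (hq : kMono q f) :
    bestQMonoApprox q n f ≤ (1 + 4 * C) * omega2 phi f (1 / (n : ℝ)) := by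
  have hn0 : (0 : ℝ) < n := by exact_mod_cast hn
  have hP0 : ∀ u ∈ Icc (0 : ℝ) 1, 0 ≤ P.eval u := hd 0 (by omega)
  have hC0 : 0 ≤ C := (mul_nonneg (by positivity) (integ_nonneg hP0)).trans hC
  set ω := omega2 phi f (1 / (n : ℝ))
  have hω : 0 ≤ ω := omega2_nonneg _ _ _
  refine le_of_forall_pos_le_add fun η hη => ?_
  set ε := η / (1 + 4 * (1 + 4 * C)) with hε
  have hε0 : 0 < ε := by positivity
  obtain ⟨g, hfg, hgq⟩ := exists_polynomial_near hf hq hε0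
  have hconv : ∀ u ∈ Icc (0 : ℝ) 1, 0 ≤ (derivative^[q] (conv P g)).eval u := by
    intro u hu
    cases q with
    | zero => exact eval_conv_nonneg h0 hP0 (hd 2 (by omega)) hgq hu
    | succ r => exact eval_iterate_derivative_conv_nonneg h0 r (hd (r + 1) (by omega)) hgq hu
  refine bestQMonoApprox_le ((natDegree_conv_le P g).trans hPn) (kMono_eval hconv) fun x hx => ?_
  have h2 := abs_conv_eval_sub_le h0 h1 hP0 (hd 2 (by omega))
    (show 0 < 1 / (n : ℝ) by positivity) (show 0 < ω + 4 * ε by positivity)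
    ((secondDiffLe_omega2 hf _).of_abs_sub_le hfg) hx
  have h3 : 4 * integ P / (1 / (n : ℝ)) ^ 2 ≤ 4 * C := by
    rw [one_div, inv_pow, div_inv_eq_mul]
    linarith
  have h4 : (ω + 4 * ε) * (1 + 4 * integ P / (1 / (n : ℝ)) ^ 2) ≤
      (ω + 4 * ε) * (1 + 4 * C) := by gcongr
  have h5 : ε * (1 + 4 * (1 + 4 * C)) = η := by
    rw [hε]
    field_simp
  have h6 := abs_sub_le (f x) (g.eval x) ((conv P g).eval x)
  linarith [hfg x hx]

end QMono

theorem statement2 (q : ℕ) :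
    ∃ c : ℝ, 0 < c ∧ ∀ n : ℕ, 1 ≤ n →
      ∀ f : ℝ → ℝ, ContinuousOn f I01 → kMono q f →
        bestQMonoApprox q n f ≤ c * omega2 phi f (1 / (n : ℝ)) := by
  have hr : 1 ≤ max q 2 - 1 := by omega
  obtain ⟨C, hC0, hC⟩ := QMono.exists_weight hr
  refine ⟨1 + 4 * C, by positivity, fun n hn f hf hq => ?_⟩
  obtain ⟨P, hPn, h0, h1, hd, hP⟩ := hC n hn
  exact QMono.bestQMonoApprox_le_omega2 hn hPn h0 h1 (fun j hj => hd j (by omega)) hP hf hq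
end
end

section
/- If L : C[0,1] → C[0,1] is a positive linear operator preserving linear functions (L(e₀) = e₀ and L(e₁) = e₁), then for any 0 ≤ λ < 2, any f ∈ C[0,1], any x ∈ [0,1], any ξ ∈ (0,1) and any h > 0: |f(x) − L(f,x)| ≤ (2 + (4/(2−λ)) · (L(e₂,x) − x² + 2(x−ξ)²) / (h² φ^{2λ}(ξ))) K_{2,φ^λ}(f, h²). -/
noncomputable section

open Set Finset
open scoped Classical

open MeasureTheory

/-- `g` is locally absolutely continuous on `(0,1)`: on every compact subinterval it is
the integral of an integrable function. -/
def LocAC (g : ℝ → ℝ) : Prop :=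
  ∀ a b : ℝ, 0 < a → a ≤ b → b < 1 →
    ∃ h : ℝ → ℝ, MeasureTheory.IntegrableOn h (Set.Icc a b) ∧
      ∀ x ∈ Set.Icc a b, g x = g a + ∫ t in a..x, h t

/-- The essential supremum of `|w · g''|` over `(0,1)` (with value in `ℝ≥0∞`). -/
def wNormE (w g : ℝ → ℝ) : ENNReal :=
  essSup (fun x => (‖w x * deriv (deriv g) x‖₊ : ENNReal))
    (MeasureTheory.volume.restrict (Set.Ioo (0 : ℝ) 1))

/-- The `K`-functional `K_{2,ψ}(f,t) = inf { ‖f-g‖ + t ‖ψ² g''‖ }`, the infimum being taken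
over all `g ∈ C[0,1]` differentiable on `(0,1)` with `g'` locally absolutely continuous
on `(0,1)`. -/
def K2fun (ψ f : ℝ → ℝ) (t : ℝ) : ℝ :=
  sInf {v : ℝ | ∃ g : ℝ → ℝ, ContinuousOn g I01 ∧
    (∀ x ∈ Set.Ioo (0 : ℝ) 1, DifferentiableAt ℝ g x) ∧
    LocAC (deriv g) ∧ wNormE (fun y => ψ y ^ 2) g ≠ ⊤ ∧
    v = supNormI (fun x => f x - g x) + t * (wNormE (fun y => ψ y ^ 2) g).toReal}

lemma AbsolutelyContinuousOnInterval.congr_eqOn {f g : ℝ → ℝ} {a b : ℝ}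
    (hf : AbsolutelyContinuousOnInterval f a b) (hfg : EqOn f g (uIcc a b)) :
    AbsolutelyContinuousOnInterval g a b := by
  rw [absolutelyContinuousOnInterval_iff] at hf ⊢
  intro ε hε
  obtain ⟨δ, hδ, H⟩ := hf ε hε
  refine ⟨δ, hδ, fun E hE hd => ?_⟩
  have := H E hE hd
  rw [Finset.sum_congr rfl] at this
  · exact this
  · intro i hi
    rw [hfg (hE.1 i hi).1, hfg (hE.1 i hi).2]

lemma LocAC.absolutelyContinuousOnInterval {g : ℝ → ℝ} (hg : LocAC g) {a b : ℝ}
    (ha : a ∈ Ioo (0 : ℝ) 1) (hb : b ∈ Ioo (0 : ℝ) 1) :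
    AbsolutelyContinuousOnInterval g a b := by
  wlog hab : a ≤ b generalizing a b
  · exact (this hb ha (le_of_not_ge hab)).symm
  obtain ⟨k, hk, hgk⟩ := hg a b ha.1 hab hb.2
  have hk' : IntervalIntegrable k volume a b := by
    rw [intervalIntegrable_iff_integrableOn_Icc_of_le hab]
    exact hk
  have h1 := hk'.absolutelyContinuousOnInterval_intervalIntegral (c := a) (by simp)
  have h2 : AbsolutelyContinuousOnInterval (fun _ : ℝ => g a) a b :=
    ContDiffOn.absolutelyContinuousOnInterval contDiffOn_const
  refine (h2.add h1).congr_eqOn fun x hx => ?_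
  rw [uIcc_of_le hab] at hx
  simpa using (hgk x hx).symm

lemma taylor_one_integral_remainder {g : ℝ → ℝ}
    (hd : ∀ x ∈ Ioo (0 : ℝ) 1, DifferentiableAt ℝ g x) (hg : LocAC (deriv g)) {ξ t : ℝ}
    (hξ : ξ ∈ Ioo (0 : ℝ) 1) (ht : t ∈ Ioo (0 : ℝ) 1) :
    g t - g ξ - deriv g ξ * (t - ξ) = ∫ s in ξ..t, (t - s) * deriv (deriv g) s := by
  have hac := hg.absolutelyContinuousOnInterval hξ ht
  have hsub : uIcc ξ t ⊆ Ioo (0 : ℝ) 1 := (convex_Ioo 0 1).ordConnected.uIcc_subset hξ ht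
  have hlin : AbsolutelyContinuousOnInterval (fun s : ℝ => t - s) ξ t :=
    ContDiffOn.absolutelyContinuousOnInterval (by fun_prop)
  have hder : (fun s => deriv (fun u : ℝ => t - u) s * deriv g s) = fun s => -deriv g s := by
    ext s
    simp
  rw [hlin.integral_mul_deriv_eq_deriv_mul hac, hder, intervalIntegral.integral_neg,
    intervalIntegral.integral_deriv_eq_sub (fun x hx => hd x (hsub hx))
      hac.continuousOn.intervalIntegrable]
  ring

lemma intervalIntegrable_abs_rpow {p : ℝ} (hp : -1 < p) (c : ℝ) :
    IntervalIntegrable (fun u : ℝ => |u| ^ p) volume 0 c := by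
  rcases le_total 0 c with hc | hc
  · refine (intervalIntegral.intervalIntegrable_rpow' hp).congr fun u hu => ?_
    rw [uIoc_of_le hc] at hu
    simp only [abs_of_pos hu.1]
  · have h := (intervalIntegral.intervalIntegrable_rpow' (a := 0) (b := -c) hp).congr
      (g := fun u : ℝ => |u| ^ p) fun u hu => by
        rw [uIoc_of_le (by linarith)] at hu
        simp only [abs_of_pos hu.1]
    have h2 := h.comp_sub_left 0
    simpa using h2

lemma abs_integral_abs_rpow {p : ℝ} (hp : -1 < p) (c : ℝ) :
    |∫ u in (0 : ℝ)..c, |u| ^ p| = |c| ^ (p + 1) / (p + 1) := by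
  have key : ∀ d : ℝ, 0 ≤ d → ∫ u in (0 : ℝ)..d, |u| ^ p = d ^ (p + 1) / (p + 1) := by
    intro d hd
    have : ∫ u in (0 : ℝ)..d, |u| ^ p = ∫ u in (0 : ℝ)..d, u ^ p := by
      refine intervalIntegral.integral_congr fun u hu => ?_
      rw [uIcc_of_le hd] at hu
      simp only [abs_of_nonneg hu.1]
    rw [this, integral_rpow (Or.inl hp), Real.zero_rpow (by linarith)]
    ring
  have hp' : 0 < p + 1 := by linarith
  rcases le_total 0 c with hc | hc
  · rw [key c hc, abs_of_nonneg hc, abs_of_nonneg (by positivity)]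
  · have h := intervalIntegral.integral_comp_neg (a := 0) (b := c) (fun u : ℝ => |u| ^ p)
    simp only [abs_neg, neg_zero] at h
    rw [h, intervalIntegral.integral_symm, key (-c) (by linarith), abs_neg, abs_of_nonpos hc,
      abs_of_nonneg]
    have : 0 ≤ -c := by linarith
    positivity

lemma abs_sub_div_le {ξ t s : ℝ} (hξ : ξ ∈ Ioo (0 : ℝ) 1) (ht : t ∈ Icc (0 : ℝ) 1)
    (hs : s ∈ uIcc ξ t) (hs' : s ∈ Ioo (0 : ℝ) 1) :
    |t - s| / (s * (1 - s)) ≤ |t - ξ| / (ξ * (1 - ξ)) := by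
  obtain ⟨h1, h2⟩ := hξ
  obtain ⟨h3, h4⟩ := hs'
  obtain ⟨h5, h6⟩ := ht
  have p1 : 0 < 1 - ξ := by linarith
  have p2 : 0 < 1 - s := by linarith
  rw [div_le_div_iff₀ (by positivity) (by positivity)]
  rcases le_total ξ t with h | h
  · rw [uIcc_of_le h] at hs
    rw [abs_of_nonneg (by linarith [hs.2]), abs_of_nonneg (by linarith)]
    have a1 : (t - s) * (1 - ξ) ≤ (t - ξ) * (1 - s) := by nlinarith [hs.1, hs.2]
    have a2 := mul_le_mul a1 hs.1 h1.le (mul_nonneg (by linarith) p2.le)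
    nlinarith
  · rw [uIcc_of_ge h] at hs
    rw [abs_of_nonpos (by linarith [hs.1]), abs_of_nonpos (by linarith)]
    have a1 : (s - t) * ξ ≤ (ξ - t) * s := by nlinarith [hs.1, hs.2]
    have a2 := mul_le_mul a1 (show 1 - ξ ≤ 1 - s by linarith [hs.2]) p1.le
      (mul_nonneg (by linarith) h3.le)
    nlinarith

lemma phi_rpow {s : ℝ} (hs : s ∈ Ioo (0 : ℝ) 1) (lam : ℝ) :
    phi s ^ (2 * lam) = (s * (1 - s)) ^ lam := by
  have : 0 ≤ s * (1 - s) := mul_nonneg hs.1.le (by linarith [hs.2])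
  rw [phi, Real.rpow_mul (Real.sqrt_nonneg _), Real.rpow_two, Real.sq_sqrt this]

lemma phi_rpow_sq {s : ℝ} (hs : s ∈ Ioo (0 : ℝ) 1) (lam : ℝ) :
    (phi s ^ lam) ^ 2 = (s * (1 - s)) ^ lam := by
  rw [← phi_rpow hs, mul_comm, Real.rpow_mul (show 0 ≤ phi s from Real.sqrt_nonneg _),
    Real.rpow_two]

lemma ae_abs_mul_le_wNormE {w g : ℝ → ℝ} (hN : wNormE w g ≠ ⊤) :
    ∀ᵐ s, s ∈ Ioo (0 : ℝ) 1 → |w s * deriv (deriv g) s| ≤ (wNormE w g).toReal := by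
  rw [← ae_restrict_iff' measurableSet_Ioo]
  filter_upwards [ENNReal.ae_le_essSup (μ := volume.restrict (Ioo (0 : ℝ) 1))
    (fun x => (‖w x * deriv (deriv g) x‖₊ : ENNReal))] with s hs
  have := ENNReal.toReal_mono hN hs
  simpa using this

lemma abs_taylor_remainder_le {lam : ℝ} (hlam : lam ∈ Ico (0 : ℝ) 2) {g : ℝ → ℝ}
    (hd : ∀ x ∈ Ioo (0 : ℝ) 1, DifferentiableAt ℝ g x) (hg : LocAC (deriv g)) {N : ℝ}
    (hN : ∀ᵐ s, s ∈ Ioo (0 : ℝ) 1 → |(s * (1 - s)) ^ lam * deriv (deriv g) s| ≤ N) {ξ t : ℝ}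
    (hξ : ξ ∈ Ioo (0 : ℝ) 1) (ht : t ∈ Ioo (0 : ℝ) 1) :
    |g t - g ξ - deriv g ξ * (t - ξ)| ≤
      N / ((2 - lam) * (ξ * (1 - ξ)) ^ lam) * (t - ξ) ^ 2 := by
  have hsub : uIcc ξ t ⊆ Ioo (0 : ℝ) 1 := (convex_Ioo 0 1).ordConnected.uIcc_subset hξ ht
  have hξ0 : 0 < ξ * (1 - ξ) := mul_pos hξ.1 (by linarith [hξ.2])
  rcases eq_or_ne t ξ with rfl | hne
  · simp
  have htξ : 0 < |t - ξ| := abs_pos.2 (sub_ne_zero.2 hne)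
  set K : ℝ := |t - ξ| / (ξ * (1 - ξ)) with hK
  have hp : -1 < 1 - lam := by linarith [hlam.2]
  have hint : IntervalIntegrable (fun s => N * K ^ lam * |t - s| ^ (1 - lam)) volume ξ t := by
    have := (intervalIntegrable_abs_rpow hp (t - ξ)).comp_sub_left t
    simp only [sub_zero, sub_sub_cancel] at this
    exact this.symm.const_mul _
  have hbound : ∀ᵐ s ∂volume.restrict (uIoc ξ t),
      ‖(t - s) * deriv (deriv g) s‖ ≤ N * K ^ lam * |t - s| ^ (1 - lam) := by
    rw [ae_restrict_iff' measurableSet_uIoc]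
    filter_upwards [hN, compl_mem_ae_iff.2 (measure_singleton t)] with s hs hst hmem
    have hs01 := hsub (uIoc_subset_uIcc hmem)
    have hs0 : 0 < s * (1 - s) := mul_pos hs01.1 (by linarith [hs01.2])
    have hts : 0 < |t - s| := abs_pos.2 (sub_ne_zero.2 fun h => hst h.symm)
    have hN' := hs hs01
    have hle := Real.rpow_le_rpow (by positivity)
      (abs_sub_div_le hξ (Ioo_subset_Icc_self ht) (uIoc_subset_uIcc hmem) hs01) hlam.1
    have hw : 0 < (s * (1 - s)) ^ lam := Real.rpow_pos_of_pos hs0 _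
    rw [abs_mul, abs_of_pos hw] at hN'
    have hN0 : 0 ≤ N := le_trans (by positivity) hN'
    rw [Real.div_rpow hts.le hs0.le] at hle
    rw [Real.norm_eq_abs, abs_mul]
    calc |t - s| * |deriv (deriv g) s|
        = |t - s| ^ lam * |t - s| ^ (1 - lam) * |deriv (deriv g) s| := by
          rw [← Real.rpow_add hts]; simp
      _ = (|t - s| ^ lam / (s * (1 - s)) ^ lam) *
            ((s * (1 - s)) ^ lam * |deriv (deriv g) s|) * |t - s| ^ (1 - lam) := by
          field_simp
      _ ≤ K ^ lam * N * |t - s| ^ (1 - lam) := by gcongr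
      _ = _ := by ring
  rw [taylor_one_integral_remainder hd hg hξ ht]
  refine (intervalIntegral.norm_integral_le_abs_of_norm_le hbound hint).trans_eq ?_
  rw [intervalIntegral.integral_const_mul,
    intervalIntegral.integral_comp_sub_left (fun u : ℝ => |u| ^ (1 - lam)) t, sub_self, abs_mul,
    abs_integral_abs_rpow hp, hK, Real.div_rpow htξ.le hξ0.le]
  have hN0 : 0 ≤ N := by
    obtain ⟨s, hs, hs'⟩ : ∃ s ∈ Ioo (0 : ℝ) 1, |(s * (1 - s)) ^ lam * deriv (deriv g) s| ≤ N := by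
      rw [← ae_restrict_iff' measurableSet_Ioo] at hN
      have : NeZero (volume.restrict (Ioo (0 : ℝ) 1)) := ⟨by simp⟩
      obtain ⟨s, hs, hs'⟩ := (hN.and (ae_restrict_mem measurableSet_Ioo)).exists
      exact ⟨s, hs', hs⟩
    exact (abs_nonneg _).trans hs'
  have hw : 0 < (ξ * (1 - ξ)) ^ lam := Real.rpow_pos_of_pos hξ0 _
  rw [abs_of_nonneg (by positivity), ← sq_abs (t - ξ), show (1 - lam + 1 : ℝ) = 2 - lam by ring]
  have h2 : |t - ξ| ^ lam * |t - ξ| ^ (2 - lam) = |t - ξ| ^ 2 := by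
    rw [← Real.rpow_add htξ, ← Real.rpow_two]; congr 1; ring
  have h3 : (2 - lam) ≠ 0 := by linarith [hlam.2]
  rw [← h2]
  field_simp

lemma abs_taylor_remainder_le_Icc {lam : ℝ} (hlam : lam ∈ Ico (0 : ℝ) 2) {g : ℝ → ℝ}
    (hc : ContinuousOn g (Icc 0 1))
    (hd : ∀ x ∈ Ioo (0 : ℝ) 1, DifferentiableAt ℝ g x) (hg : LocAC (deriv g)) {N : ℝ}
    (hN : ∀ᵐ s, s ∈ Ioo (0 : ℝ) 1 → |(s * (1 - s)) ^ lam * deriv (deriv g) s| ≤ N) {ξ t : ℝ}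
    (hξ : ξ ∈ Ioo (0 : ℝ) 1) (ht : t ∈ Icc (0 : ℝ) 1) :
    |g t - g ξ - deriv g ξ * (t - ξ)| ≤
      N / ((2 - lam) * (ξ * (1 - ξ)) ^ lam) * (t - ξ) ^ 2 := by
  have hcl : closure (Ioo (0 : ℝ) 1) = Set.Icc 0 1 := closure_Ioo (by norm_num)
  rw [← hcl] at ht hc
  refine le_on_closure (s := Ioo (0 : ℝ) 1)
    (f := fun t => |g t - g ξ - deriv g ξ * (t - ξ)|)
    (g := fun t => N / ((2 - lam) * (ξ * (1 - ξ)) ^ lam) * (t - ξ) ^ 2)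
    (fun t ht => abs_taylor_remainder_le hlam hd hg hN hξ ht) ?_ (by fun_prop) ht
  fun_prop

namespace PositiveLinearOp

variable {L : (ℝ → ℝ) → (ℝ → ℝ)} {f g : ℝ → ℝ} {x : ℝ}

lemma map_sub (hL : PositiveLinearOp L) (hf : ContinuousOn f I01) (hg : ContinuousOn g I01)
    (hx : x ∈ I01) : L (fun y => f y - g y) x = L f x - L g x := by
  have h := hL.1 f (fun y => -1 * g y) hf (by fun_prop) x hx
  rw [hL.2.1 (-1) g hg x hx] at h
  simpa [sub_eq_add_neg] using h

lemma mono (hL : PositiveLinearOp L) (hf : ContinuousOn f I01) (hg : ContinuousOn g I01)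
    (hfg : ∀ y ∈ I01, f y ≤ g y) (hx : x ∈ I01) : L f x ≤ L g x := by
  have h := hL.2.2.2 (fun y => g y - f y) (hg.sub hf) (fun y hy => sub_nonneg.2 (hfg y hy)) x hx
  rw [hL.map_sub hg hf hx] at h
  linarith

lemma abs_le (hL : PositiveLinearOp L) (hf : ContinuousOn f I01) (hg : ContinuousOn g I01)
    (hfg : ∀ y ∈ I01, |f y| ≤ g y) (hx : x ∈ I01) : |L f x| ≤ L g x := by
  rw [_root_.abs_le]
  constructor
  · have h := hL.mono (f := fun y => -1 * g y) (by fun_prop) hf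
      (fun y hy => by linarith [(_root_.abs_le.1 (hfg y hy)).1]) hx
    rw [hL.2.1 (-1) g hg x hx] at h
    linarith
  · exact hL.mono hf hg (fun y hy => (_root_.abs_le.1 (hfg y hy)).2) hx

lemma map_const (hL : PositiveLinearOp L) (hL0 : ∀ x ∈ I01, L (fun _ => 1) x = 1)
    (hx : x ∈ I01) (c : ℝ) : L (fun _ => c) x = c := by
  have h := hL.2.1 c (fun _ => 1) continuousOn_const x hx
  simpa [hL0 x hx] using h

lemma map_affine (hL : PositiveLinearOp L) (hL0 : ∀ x ∈ I01, L (fun _ => 1) x = 1)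
    (hL1 : ∀ x ∈ I01, L (fun y => y) x = x) (hx : x ∈ I01) (c d : ℝ) :
    L (fun y => c + d * y) x = c + d * x := by
  rw [hL.1 (fun _ => c) (fun y => d * y) (by fun_prop) (by fun_prop) x hx,
    hL.map_const hL0 hx, hL.2.1 d (fun y => y) (by fun_prop) x hx, hL1 x hx]

lemma map_sub_sq (hL : PositiveLinearOp L) (hL0 : ∀ x ∈ I01, L (fun _ => 1) x = 1)
    (hL1 : ∀ x ∈ I01, L (fun y => y) x = x) (hx : x ∈ I01) (ξ : ℝ) :
    L (fun y => (y - ξ) ^ 2) x = L (fun y => y ^ 2) x - x ^ 2 + (x - ξ) ^ 2 := by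
  have : (fun y : ℝ => (y - ξ) ^ 2) = fun y => y ^ 2 + (ξ ^ 2 + (-2 * ξ) * y) := by
    ext y; ring
  rw [this, hL.1 (fun y => y ^ 2) (fun y => ξ ^ 2 + (-2 * ξ) * y) (by fun_prop) (by fun_prop) x hx,
    hL.map_affine hL0 hL1 hx]
  ring

lemma abs_sub_le_of_quadratic (hL : PositiveLinearOp L)
    (hL0 : ∀ x ∈ I01, L (fun _ => 1) x = 1) (hL1 : ∀ x ∈ I01, L (fun y => y) x = x)
    (hx : x ∈ I01) (hg : ContinuousOn g I01) {m ξ C : ℝ}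
    (hq : ∀ y ∈ I01, |g y - g ξ - m * (y - ξ)| ≤ C * (y - ξ) ^ 2) :
    |g x - L g x| ≤ C * (L (fun y => y ^ 2) x - x ^ 2 + 2 * (x - ξ) ^ 2) := by
  have haff := hL.map_affine hL0 hL1 hx (g ξ - m * ξ) m
  have h1 := hL.abs_le (f := fun y => g y - (g ξ - m * ξ + m * y))
    (g := fun y => C * (y - ξ) ^ 2) (by fun_prop) (by fun_prop)
    (fun y hy => by convert hq y hy using 2; ring) hx
  rw [hL.map_sub hg (by fun_prop) hx, haff,
    hL.2.1 C (fun y => (y - ξ) ^ 2) (by fun_prop) x hx, hL.map_sub_sq hL0 hL1 hx] at h1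
  have h2 := hq x hx
  calc |g x - L g x|
      = |(g x - g ξ - m * (x - ξ)) - (L g x - (g ξ - m * ξ + m * x))| := by congr 1; ring
    _ ≤ |g x - g ξ - m * (x - ξ)| + |L g x - (g ξ - m * ξ + m * x)| := abs_sub _ _
    _ ≤ _ := by linarith

end PositiveLinearOp

lemma abs_le_supNormI {f : ℝ → ℝ} (hf : ContinuousOn f I01) {x : ℝ} (hx : x ∈ I01) :
    |f x| ≤ supNormI f := by
  obtain ⟨C, hC⟩ := isCompact_Icc.exists_bound_of_continuousOn hf
  refine le_csSup ⟨C, ?_⟩ ⟨x, hx, rfl⟩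
  rintro v ⟨y, hy, rfl⟩
  exact hC y hy

theorem statement3 (L : (ℝ → ℝ) → (ℝ → ℝ)) (hL : PositiveLinearOp L)
    (hL0 : ∀ x ∈ I01, L (fun _ => 1) x = 1)
    (hL1 : ∀ x ∈ I01, L (fun y => y) x = x)
    (lam : ℝ) (hlam : lam ∈ Set.Ico (0 : ℝ) 2)
    (f : ℝ → ℝ) (hf : ContinuousOn f I01)
    (x : ℝ) (hx : x ∈ I01) (ξ : ℝ) (hξ : ξ ∈ Set.Ioo (0 : ℝ) 1)
    (h : ℝ) (hh : 0 < h) :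
    |f x - L f x| ≤
      (2 + 4 / (2 - lam) *
          ((L (fun y => y ^ 2) x - x ^ 2 + 2 * (x - ξ) ^ 2) /
            (h ^ 2 * phi ξ ^ (2 * lam)))) *
        K2fun (fun y => phi y ^ lam) f (h ^ 2) := by
  have hξ0 : 0 < ξ * (1 - ξ) := mul_pos hξ.1 (by linarith [hξ.2])
  have hw : 0 < (ξ * (1 - ξ)) ^ lam := Real.rpow_pos_of_pos hξ0 _
  have h2 : 0 < 2 - lam := by linarith [hlam.2]
  have hvar : 0 ≤ L (fun y => y ^ 2) x - x ^ 2 := by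
    have h0 := hL.2.2.2 (fun y => (y - x) ^ 2) (by fun_prop) (fun y _ => sq_nonneg _) x hx
    rw [hL.map_sub_sq hL0 hL1 hx] at h0
    simpa using h0
  rw [phi_rpow hξ]
  set A : ℝ := L (fun y => y ^ 2) x - x ^ 2 + 2 * (x - ξ) ^ 2 with hA
  have hA0 : 0 ≤ A := by positivity
  have hcoef : 0 < 2 + 4 / (2 - lam) * (A / (h ^ 2 * (ξ * (1 - ξ)) ^ lam)) := by positivity
  rw [← div_le_iff₀' hcoef]
  refine le_csInf ?_ ?_
  · refine ⟨_, fun _ => 0, continuousOn_const, fun _ _ => differentiableAt_const _, ?_, ?_, rfl⟩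
    · intro a b _ _ _
      exact ⟨fun _ => 0, integrableOn_zero, by simp⟩
    · have h0 : wNormE (fun y => (phi y ^ lam) ^ 2) (fun _ => 0) = 0 := by
        rw [wNormE, ENNReal.essSup_eq_zero_iff]
        exact Filter.Eventually.of_forall fun s => by simp
      simp [h0]
  · rintro v ⟨g, hgc, hgd, hgac, hgN, rfl⟩
    rw [div_le_iff₀' hcoef]
    set N := (wNormE (fun y => (phi y ^ lam) ^ 2) g).toReal with hNdef
    set S := supNormI (fun x => f x - g x) with hS
    have hN0 : 0 ≤ N := ENNReal.toReal_nonneg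
    have hfg : ContinuousOn (fun y => f y - g y) I01 := hf.sub hgc
    have hSle : ∀ y ∈ I01, |f y - g y| ≤ S := fun y hy => abs_le_supNormI hfg hy
    have hS0 : 0 ≤ S := (abs_nonneg _).trans (hSle x hx)
    have hae : ∀ᵐ s, s ∈ Ioo (0 : ℝ) 1 → |(s * (1 - s)) ^ lam * deriv (deriv g) s| ≤ N := by
      filter_upwards [ae_abs_mul_le_wNormE hgN] with s hs hs01
      rw [← phi_rpow_sq hs01]
      exact hs hs01
    have hgL := hL.abs_sub_le_of_quadratic hL0 hL1 hx hgc (fun y hy =>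
      abs_taylor_remainder_le_Icc hlam hgc hgd hgac hae hξ hy)
    rw [← hA] at hgL
    have hLfg := hL.abs_le hfg continuousOn_const hSle hx
    rw [hL.map_sub hf hgc hx, hL.map_const hL0 hx] at hLfg
    have htri : |f x - L f x| ≤ |f x - g x| + |L f x - L g x| + |g x - L g x| := by
      have e : f x - L f x = (f x - g x) - (L f x - L g x) + (g x - L g x) := by ring
      rw [e]
      exact (abs_add_le _ _).trans (by gcongr; exact abs_sub _ _)
    have hexp : (2 + 4 / (2 - lam) * (A / (h ^ 2 * (ξ * (1 - ξ)) ^ lam))) * (S + h ^ 2 * N) =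
        2 * S + N / ((2 - lam) * (ξ * (1 - ξ)) ^ lam) * A +
        (2 * h ^ 2 * N + 4 / (2 - lam) * (A / (h ^ 2 * (ξ * (1 - ξ)) ^ lam)) * S +
          3 * (N / ((2 - lam) * (ξ * (1 - ξ)) ^ lam) * A)) := by
      field_simp
      ring
    have hrest : 0 ≤ 2 * h ^ 2 * N + 4 / (2 - lam) * (A / (h ^ 2 * (ξ * (1 - ξ)) ^ lam)) * S +
          3 * (N / ((2 - lam) * (ξ * (1 - ξ)) ^ lam) * A) := by positivity
    rw [hexp]
    linarith [hSle x hx]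
end
end

section
/- Let L_n : C[0,1] → Π_n be a sequence of positive linear polynomial operators preserving linear functions, and suppose α_n > 0 are such that L_n(e₂, x) − x² = α_n φ²(x) for all x ∈ [0,1]. Then there exist an absolute constant c₀ > 0 and, for each λ ∈ [0,2), a constant c > 0 depending only on λ, such that for all f ∈ C[0,1], x ∈ [0,1] and 0 < h ≤ c₀: |f(x) − L_n(f,x)| ≤ c (1 + α_n φ^{2−λ}(x) / (h² (φ(x) + √(min{α_n, 1/4}))^λ)) ω₂^{φ^λ}(f,h). -/
noncomputable section

open Set Finset
open scoped Classical

/-- Quadratic lower bound for a concave power around `1`. -/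
theorem one_add_mul_sub_sq_le_rpow {p s : ℝ} (hp0 : 0 < p) (hp1 : p ≤ 1) (hs : 0 ≤ s) :
    1 + p * (s - 1) - (s - 1) ^ 2 ≤ s ^ p := by
  rcases hs.eq_or_lt with rfl | hs
  · rw [Real.zero_rpow hp0.ne']
    linarith
  have hB : s ^ (1 - p) ≤ 1 + (1 - p) * (s - 1) := by
    have := rpow_one_add_le_one_add_mul_self (s := s - 1) (p := 1 - p)
      (by linarith) (by linarith) (by linarith)
    simpa using this
  have hA : 0 < s ^ p := Real.rpow_pos_of_pos hs p
  have hAB : s ^ p * s ^ (1 - p) = s := by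
    rw [← Real.rpow_add hs]
    simp
  set A := s ^ p
  set D := 1 + (1 - p) * (s - 1) with hD
  have h1 : s ≤ A * D := hAB ▸ mul_le_mul_of_nonneg_left hB hA.le
  have h2 : s * (2 - D) ≤ A := by
    by_cases h : 0 ≤ 2 - D
    · nlinarith [mul_le_mul_of_nonneg_right h1 h, mul_nonneg hA.le (sq_nonneg (D - 1))]
    · nlinarith
  nlinarith [mul_nonneg hp0.le (sq_nonneg (s - 1))]

/-- Quadratic lower bound for a concave power around `y`. -/
theorem rpow_quadratic_lower {p y t : ℝ} (hp0 : 0 < p) (hp1 : p ≤ 1) (hy : 0 < y) (ht : 0 ≤ t) :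
    y ^ p + p * (y ^ p / y) * (t - y) - y ^ p / y ^ 2 * (t - y) ^ 2 ≤ t ^ p := by
  have h := one_add_mul_sub_sq_le_rpow hp0 hp1 (div_nonneg ht hy.le)
  have hm := mul_le_mul_of_nonneg_left h (Real.rpow_nonneg hy.le p)
  rw [← Real.mul_rpow hy.le (div_nonneg ht hy.le), mul_div_cancel₀ _ hy.ne'] at hm
  refine le_trans (le_of_eq ?_) hm
  field_simp

/-- Strict concavity of a small power, quantified by its second difference at `1`. -/
theorem rpow_one_add_add_rpow_one_sub_le {p s : ℝ} (hp0 : 0 < p) (hp : p ≤ 1 / 2)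
    (hs0 : 0 ≤ s) (hs1 : s ≤ 1) :
    (1 + s) ^ p + (1 - s) ^ p ≤ 2 - p ^ 2 / 2 * s ^ 2 := by
  have h1 := rpow_one_add_le_one_add_mul_self (s := s) (p := p)
    (by linarith) hp0.le (by linarith)
  have h2 := rpow_one_add_le_one_add_mul_self (s := -s) (p := 2 * p)
    (by linarith) (by linarith) (by linarith)
  rw [← sub_eq_add_neg] at h2
  have h3 : (1 - s) ^ (2 * p) = ((1 - s) ^ p) ^ 2 := by
    rw [mul_comm, Real.rpow_mul (by linarith)]
    norm_cast
  have hps0 : 0 ≤ p * s := mul_nonneg hp0.le hs0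
  have hps : p * s ≤ 1 / 2 := by nlinarith
  have h4 : (1 - s) ^ p ≤ 1 - p * s - (p * s) ^ 2 / 2 := by
    refine le_of_pow_le_pow_left₀ two_ne_zero (by nlinarith) ?_
    rw [h3] at h2
    nlinarith [pow_nonneg hps0 3, pow_nonneg hps0 4]
  nlinarith

/-- Second differences of a small power. -/
theorem rpow_second_difference_le {p u δ : ℝ} (hp0 : 0 < p) (hp : p ≤ 1 / 2) (hu : 0 < u)
    (hδ0 : 0 ≤ δ) (hδ : δ ≤ u) :
    (u + δ) ^ p + (u - δ) ^ p ≤ 2 * u ^ p - p ^ 2 / 2 * δ ^ 2 * (u ^ p / u ^ 2) := by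
  have hs1 : δ / u ≤ 1 := (div_le_one hu).2 hδ
  have hs0 : 0 ≤ δ / u := div_nonneg hδ0 hu.le
  have h := mul_le_mul_of_nonneg_left (rpow_one_add_add_rpow_one_sub_le hp0 hp hs0 hs1)
    (Real.rpow_nonneg hu.le p)
  rw [mul_add, ← Real.mul_rpow hu.le (by linarith), ← Real.mul_rpow hu.le (by linarith)] at h
  have e1 : u * (1 + δ / u) = u + δ := by field_simp
  have e2 : u * (1 - δ / u) = u - δ := by field_simp
  rw [e1, e2] at h
  refine h.trans (le_of_eq ?_)
  field_simp

/-- The comparison function: a parabola corrected by concave powers at both endpoints. -/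
def barrier (p K t : ℝ) : ℝ := t ^ 2 - K * t ^ p - K * (1 - t) ^ p

theorem continuous_barrier {p : ℝ} (hp : 0 < p) (K : ℝ) : Continuous (barrier p K) := by
  unfold barrier
  have h1 : Continuous fun t : ℝ => t ^ p := Real.continuous_rpow_const hp.le
  have h2 : Continuous fun t : ℝ => (1 - t) ^ p := h1.comp (continuous_const.sub continuous_id)
  fun_prop

theorem barrier_second_difference {p K u δ : ℝ} (hp0 : 0 < p) (hp : p ≤ 1 / 2) (hK : 0 ≤ K)
    (hδ0 : 0 ≤ δ) (hu : 0 < u) (hu1 : u < 1) (h0 : 0 ≤ u - δ) (h1 : u + δ ≤ 1) :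
    p ^ 2 / 2 * δ ^ 2 * (1 + K * ((u * (1 - u)) ^ p / (u * (1 - u)) ^ 2) / 2) ≤
      barrier p K (u - δ) - 2 * barrier p K u + barrier p K (u + δ) := by
  have hv : 0 < 1 - u := by linarith
  have e1 := mul_le_mul_of_nonneg_left
    (rpow_second_difference_le hp0 hp hu hδ0 (by linarith)) hK
  have e2 := mul_le_mul_of_nonneg_left
    (rpow_second_difference_le hp0 hp hv hδ0 (by linarith)) hK
  have hw : (u * (1 - u)) ^ p / (u * (1 - u)) ^ 2 / 2 ≤
      u ^ p / u ^ 2 + (1 - u) ^ p / (1 - u) ^ 2 := by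
    rw [Real.mul_rpow hu.le hv.le]
    have a1 : u ^ p ≤ 1 := Real.rpow_le_one hu.le hu1.le hp0.le
    have a2 : (1 - u) ^ p ≤ 1 := Real.rpow_le_one hv.le (by linarith) hp0.le
    have b1 := Real.rpow_pos_of_pos hu p
    have b2 := Real.rpow_pos_of_pos hv p
    rw [div_add_div _ _ (by positivity) (by positivity), mul_pow, div_div,
      div_le_div_iff₀ (by positivity) (by positivity)]
    have key : u ^ p * (1 - u) ^ p ≤ 2 * (u ^ p * (1 - u) ^ 2 + u ^ 2 * (1 - u) ^ p) := by
      have c1 := mul_le_mul_of_nonneg_left a2 b1.le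
      have c2 := mul_le_mul_of_nonneg_right a1 b2.le
      have d1 := mul_le_mul_of_nonneg_right c1 (sq_nonneg (1 - u))
      have d2 := mul_le_mul_of_nonneg_right c2 (sq_nonneg u)
      have d3 := mul_nonneg (mul_pos b1 b2).le (sq_nonneg (2 * u - 1))
      nlinarith
    have := mul_le_mul_of_nonneg_right key (mul_pos (pow_pos hu 2) (pow_pos hv 2)).le
    nlinarith
  have hw' := mul_le_mul_of_nonneg_left hw
    (mul_nonneg (by positivity : 0 ≤ p ^ 2 / 2 * δ ^ 2) hK)
  have hp2 : p ^ 2 / 2 * δ ^ 2 ≤ 2 * δ ^ 2 :=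
    mul_le_mul_of_nonneg_right (by nlinarith) (sq_nonneg δ)
  unfold barrier
  rw [show 1 - (u - δ) = 1 - u + δ by ring, show 1 - (u + δ) = 1 - u - δ by ring]
  nlinarith

/-- At the step `h φ^λ`, the barrier has second differences bounded away from zero. -/
theorem barrier_second_difference_phi {p lam M h u : ℝ} (hp0 : 0 < p) (hp : p ≤ 1 / 2)
    (hlam0 : 0 ≤ lam) (hlam : lam ≤ 2 - p) (hM : 0 < M) (hh : 0 < h) (hu : 0 < u) (hu1 : u < 1)
    (h0 : 0 ≤ u - h * phi u ^ lam) (h1 : u + h * phi u ^ lam ≤ 1) :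
    p ^ 2 / 4 * h ^ 2 * M ^ lam ≤
      barrier p (M ^ (2 - p)) (u - h * phi u ^ lam) - 2 * barrier p (M ^ (2 - p)) u +
        barrier p (M ^ (2 - p)) (u + h * phi u ^ lam) := by
  have hw : 0 < u * (1 - u) := mul_pos hu (by linarith)
  have hphi : 0 ≤ phi u := Real.sqrt_nonneg _
  refine le_trans ?_ (barrier_second_difference hp0 hp (Real.rpow_nonneg hM.le _)
    (mul_nonneg hh.le (Real.rpow_nonneg hphi _)) hu hu1 h0 h1)
  have hsq : (phi u ^ lam) ^ 2 = (u * (1 - u)) ^ lam := by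
    rw [← Real.rpow_natCast, ← Real.rpow_mul hphi, mul_comm, Real.rpow_mul hphi]
    congr 1
    rw [Real.rpow_natCast]
    exact Real.sq_sqrt hw.le
  rw [mul_pow, hsq]
  set w := u * (1 - u)
  suffices hs : M ^ lam ≤ 2 * (w ^ lam * (1 + M ^ (2 - p) * (w ^ p / w ^ 2) / 2)) by
    have := mul_le_mul_of_nonneg_left hs (by positivity : 0 ≤ p ^ 2 / 4 * h ^ 2)
    linarith
  have hW : 0 < w ^ lam := Real.rpow_pos_of_pos hw _
  rcases le_total M w with hMw | hMw
  · have a := Real.rpow_le_rpow hM.le hMw hlam0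
    have b : 0 ≤ M ^ (2 - p) * (w ^ p / w ^ 2) := by positivity
    nlinarith
  · have hq : w ^ p / w ^ 2 = (w ^ (2 - p))⁻¹ := by
      rw [← Real.rpow_neg hw.le, neg_sub, Real.rpow_sub hw]
      norm_cast
    have a : w ^ (2 - p - lam) ≤ M ^ (2 - p - lam) :=
      Real.rpow_le_rpow hw.le hMw (by linarith)
    rw [Real.rpow_sub hw, Real.rpow_sub hM, div_le_div_iff₀ hW (by positivity)] at a
    have hwp := Real.rpow_pos_of_pos hw (2 - p)
    have c : M ^ lam ≤ w ^ lam * (M ^ (2 - p) * (w ^ p / w ^ 2)) := by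
      rw [hq, ← mul_assoc, ← div_eq_mul_inv, le_div_iff₀ hwp]
      linarith
    nlinarith

/-- Quadratic upper bound for `-M^(2-p) t^p`, adapted to a given variance `V`. -/
theorem neg_rpow_quadratic_upper {p M y V : ℝ} (hp0 : 0 < p) (hp1 : p ≤ 1) (hM : 0 < M)
    (hy : 0 < y) (hV : 0 ≤ V) (hMy : M ≤ y ∨ M ^ 2 ≤ V) :
    ∃ a b c : ℝ, b * V + c ≤ V ∧ ∀ t, 0 ≤ t →
      -(M ^ (2 - p) * t ^ p) ≤ -(M ^ (2 - p) * y ^ p) + a * (t - y) + b * (t - y) ^ 2 + c := by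
  have hK := Real.rpow_pos_of_pos hM (2 - p)
  have hKM : M ^ (2 - p) * M ^ p = M ^ 2 := by
    rw [← Real.rpow_add hM]
    norm_num
  by_cases h : M ≤ y
  · refine ⟨-(M ^ (2 - p) * (p * (y ^ p / y))), M ^ (2 - p) * (y ^ p / y ^ 2), 0, ?_, ?_⟩
    · have h1 : M ^ (2 - p) ≤ y ^ (2 - p) := Real.rpow_le_rpow hM.le h (by linarith)
      have h2 : y ^ (2 - p) * (y ^ p / y ^ 2) = 1 := by
        rw [← mul_div_assoc, ← Real.rpow_add hy]
        simp [hy.ne']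
      have h3 := mul_le_mul_of_nonneg_right h1 (by positivity : 0 ≤ y ^ p / y ^ 2)
      nlinarith
    · intro t ht
      have := mul_le_mul_of_nonneg_left (rpow_quadratic_lower hp0 hp1 hy ht) hK.le
      linarith
  · have h' := hMy.resolve_left h
    refine ⟨0, 0, M ^ (2 - p) * y ^ p, ?_, ?_⟩
    · have := mul_le_mul_of_nonneg_left
        (Real.rpow_le_rpow hy.le (not_le.1 h).le hp0.le) hK.le
      linarith
    · intro t ht
      have := mul_nonneg hK.le (Real.rpow_nonneg ht p)
      linarith

theorem barrier_quadratic_upper {p M x V : ℝ} (hp0 : 0 < p) (hp1 : p ≤ 1) (hM : 0 < M)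
    (hx0 : 0 < x) (hx1 : x < 1) (hV : 0 ≤ V) (h0 : M ≤ x ∨ M ^ 2 ≤ V)
    (h1 : M ≤ 1 - x ∨ M ^ 2 ≤ V) :
    ∃ a b c : ℝ, b * V + c ≤ 3 * V ∧ ∀ t ∈ I01,
      barrier p (M ^ (2 - p)) t ≤
        barrier p (M ^ (2 - p)) x + a * (t - x) + b * (t - x) ^ 2 + c := by
  obtain ⟨a, b, c, hV1, hb1⟩ := neg_rpow_quadratic_upper hp0 hp1 hM hx0 hV h0
  obtain ⟨a', b', c', hV2, hb2⟩ :=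
    neg_rpow_quadratic_upper hp0 hp1 hM (sub_pos.2 hx1) hV h1
  refine ⟨a - a' + 2 * x, b + b' + 1, c + c', by linarith, fun t ht => ?_⟩
  have e1 := hb1 t ht.1
  have e2 := hb2 (1 - t) (sub_nonneg.2 ht.2)
  unfold barrier
  nlinarith

theorem centralDiff_two {f : ℝ → ℝ} {δ x : ℝ} (h0 : x - δ ∈ I01) (h1 : x + δ ∈ I01) :
    centralDiff 2 δ f x = f (x - δ) - 2 * f x + f (x + δ) := by
  have e : ((2 : ℕ) : ℝ) * δ / 2 = δ := by push_cast; ring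
  unfold centralDiff
  rw [e, if_pos ⟨h0, h1⟩]
  simp only [Finset.sum_range_succ, Finset.sum_range_zero]
  norm_num
  rw [show x - δ + 2 * δ = x + δ by ring]
  ring

theorem exists_abs_centralDiff_two_le {f : ℝ → ℝ} (hf : ContinuousOn f I01) :
    ∃ C, ∀ x ∈ I01, ∀ δ, |centralDiff 2 δ f x| ≤ C := by
  obtain ⟨B, hB⟩ := (isCompact_Icc : IsCompact I01).exists_bound_of_continuousOn hf
  refine ⟨4 * B, fun x hx δ => ?_⟩
  have hB0 : |f x| ≤ B := hB x hx
  by_cases h : x - δ ∈ I01 ∧ x + δ ∈ I01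
  · rw [centralDiff_two h.1 h.2]
    have h1 := hB _ h.1
    have h2 := hB _ h.2
    rw [Real.norm_eq_abs] at h1 h2
    rw [abs_le] at *
    constructor <;> linarith
  · have e : ((2 : ℕ) : ℝ) * δ / 2 = δ := by push_cast; ring
    unfold centralDiff
    rw [e, if_neg h, abs_zero]
    linarith [abs_nonneg (f x)]

theorem abs_second_difference_le_omega2 {f ψ : ℝ → ℝ} (hf : ContinuousOn f I01) {s t x : ℝ}
    (hs : 0 < s) (hst : s ≤ t) (hx : x ∈ I01) (h0 : x - s * ψ x ∈ I01)
    (h1 : x + s * ψ x ∈ I01) :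
    |f (x - s * ψ x) - 2 * f x + f (x + s * ψ x)| ≤ omega2 ψ f t := by
  obtain ⟨C, hC⟩ := exists_abs_centralDiff_two_le hf
  rw [← centralDiff_two h0 h1]
  refine le_csSup ⟨C, ?_⟩ ⟨s, x, hs, hst, hx, rfl⟩
  rintro v ⟨s, x, -, -, hx, rfl⟩
  exact hC x hx _

theorem omega2_nonneg (ψ f : ℝ → ℝ) (t : ℝ) : 0 ≤ omega2 ψ f t := by
  refine Real.sSup_nonneg ?_
  rintro v ⟨s, x, -, -, -, rfl⟩
  exact abs_nonneg _

theorem omega2_neg (ψ f : ℝ → ℝ) (t : ℝ) : omega2 ψ (fun y => -f y) t = omega2 ψ f t := by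
  have h : ∀ δ x, |centralDiff 2 δ (fun y => -f y) x| = |centralDiff 2 δ f x| := by
    intro δ x
    unfold centralDiff
    split_ifs
    · rw [← abs_neg, ← Finset.sum_neg_distrib]
      simp
    · rfl
  unfold omega2
  simp only [h]

/-- A maximum principle: a function that is strictly convex at a step `d` depending on the centre
and almost convex at all smaller steps stays below its chords up to the error `W`. -/
theorem le_chord_of_second_difference {H d : ℝ → ℝ} {W t₁ t₂ : ℝ} (hW : 0 ≤ W)
    (hH : ContinuousOn H (Set.Icc t₁ t₂)) (h1 : H t₁ = 0) (h2 : H t₂ = 0)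
    (hstrict : ∀ m ∈ Set.Ioo t₁ t₂, t₁ ≤ m - d m → m + d m ≤ t₂ →
      0 < H (m - d m) - 2 * H m + H (m + d m))
    (hweak : ∀ m ∈ Set.Ioo t₁ t₂, ∀ δ, 0 < δ → δ ≤ d m → t₁ ≤ m - δ → m + δ ≤ t₂ →
      -W ≤ H (m - δ) - 2 * H m + H (m + δ)) (hd : ∀ m ∈ Set.Ioo t₁ t₂, 0 < d m)
    {x : ℝ} (hx : x ∈ Set.Icc t₁ t₂) : H x ≤ W := by
  obtain ⟨m, hm, hmax⟩ := isCompact_Icc.exists_isMaxOn ⟨x, hx⟩ hH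
  have hmax' : ∀ y, t₁ ≤ y → y ≤ t₂ → H y ≤ H m := fun y a b =>
    hmax (show y ∈ Set.Icc t₁ t₂ from ⟨a, b⟩)
  refine (hmax' x hx.1 hx.2).trans ?_
  rcases hm.1.eq_or_lt with rfl | hm1
  · linarith
  rcases hm.2.eq_or_lt with rfl | hm2
  · linarith
  have hm' : m ∈ Set.Ioo t₁ t₂ := ⟨hm1, hm2⟩
  have hdm := hd m hm'
  by_cases hc : t₁ ≤ m - d m ∧ m + d m ≤ t₂
  · have := hstrict m hm' hc.1 hc.2
    have a := hmax' (m - d m) hc.1 (by linarith)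
    have b := hmax' (m + d m) (by linarith) hc.2
    linarith
  rw [not_and_or, not_le, not_le] at hc
  rcases le_total (m - t₁) (t₂ - m) with hle | hle
  · have := hweak m hm' (m - t₁) (by linarith) (by rcases hc with hc | hc <;> linarith)
      (by linarith) (by linarith)
    rw [sub_sub_cancel, h1] at this
    have b := hmax' (m + (m - t₁)) (by linarith) (by linarith)
    linarith
  · have := hweak m hm' (t₂ - m) (by linarith) (by rcases hc with hc | hc <;> linarith)
      (by linarith) (by linarith)
    rw [add_sub_cancel, h2] at this
    have b := hmax' (m - (t₂ - m)) (by linarith) (by linarith)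
    linarith

/-- The maximum principle yields an approximate supporting line at interior points. -/
theorem exists_support_line {F d : ℝ → ℝ} {W x : ℝ} (hW : 0 ≤ W) (hF : ContinuousOn F I01)
    (hd : ∀ m ∈ Set.Ioo (0 : ℝ) 1, 0 < d m)
    (hstrict : ∀ m ∈ Set.Ioo (0 : ℝ) 1, 0 ≤ m - d m → m + d m ≤ 1 →
      0 < F (m - d m) - 2 * F m + F (m + d m))
    (hweak : ∀ m ∈ Set.Ioo (0 : ℝ) 1, ∀ δ, 0 < δ → δ ≤ d m → 0 ≤ m - δ → m + δ ≤ 1 →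
      -W ≤ F (m - δ) - 2 * F m + F (m + δ)) (hx : x ∈ Set.Ioo (0 : ℝ) 1) :
    ∃ a : ℝ, ∀ t ∈ I01, F x - W + a * (t - x) ≤ F t := by
  have key : ∀ t₁ t₂, 0 ≤ t₁ → t₁ < x → x < t₂ → t₂ ≤ 1 →
      (F x - W - F t₁) / (x - t₁) ≤ (F t₂ - F x + W) / (t₂ - x) := by
    intro t₁ t₂ h0 h1 h2 h3
    set k := (F t₂ - F t₁) / (t₂ - t₁) with hk
    have hk' : k * (t₂ - t₁) = F t₂ - F t₁ := div_mul_cancel₀ _ (by linarith)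
    have hsub : ∀ m ∈ Set.Ioo t₁ t₂, m ∈ Set.Ioo (0 : ℝ) 1 := fun m hm =>
      ⟨by linarith [hm.1], by linarith [hm.2]⟩
    have hH : ContinuousOn (fun t => F t - F t₁ - k * (t - t₁)) (Set.Icc t₁ t₂) := by
      have : ContinuousOn F (Set.Icc t₁ t₂) := hF.mono (Set.Icc_subset_Icc h0 h3)
      fun_prop
    have := le_chord_of_second_difference (d := d) hW hH (by simp) (by linarith)
      (fun m hm a b => by
        have := hstrict m (hsub m hm) (by linarith) (by linarith)
        linarith)
      (fun m hm δ hδ hδd a b => by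
        have := hweak m (hsub m hm) δ hδ hδd (by linarith) (by linarith)
        linarith)
      (fun m hm => hd m (hsub m hm)) (x := x) ⟨h1.le, h2.le⟩
    have l1 : (F x - W - F t₁) / (x - t₁) ≤ k := by
      rw [div_le_iff₀ (by linarith)]
      linarith
    have l2 : k ≤ (F t₂ - F x + W) / (t₂ - x) := by
      rw [le_div_iff₀ (by linarith)]
      linarith
    exact l1.trans l2
  set S := (fun t => (F x - W - F t) / (x - t)) '' Set.Ico 0 x with hS
  have hne : S.Nonempty := ⟨_, 0, ⟨le_rfl, hx.1⟩, rfl⟩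
  have hub : ∀ t₂, x < t₂ → t₂ ≤ 1 → (F t₂ - F x + W) / (t₂ - x) ∈ upperBounds S := by
    rintro t₂ h2 h3 _ ⟨t₁, ht, rfl⟩
    exact key t₁ t₂ ht.1 ht.2 h2 h3
  refine ⟨sSup S, fun t ht => ?_⟩
  rcases lt_trichotomy t x with h | rfl | h
  · have := le_csSup ⟨_, hub 1 hx.2 le_rfl⟩ (⟨t, ⟨ht.1, h⟩, rfl⟩ : _ ∈ S)
    rw [div_le_iff₀ (by linarith)] at this
    linarith
  · linarith
  · have := csSup_le hne (hub t h ht.2)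
    rw [le_div_iff₀ (by linarith)] at this
    linarith

theorem phi_pos {x : ℝ} (hx : x ∈ Set.Ioo (0 : ℝ) 1) : 0 < phi x :=
  Real.sqrt_pos.2 (mul_pos hx.1 (sub_pos.2 hx.2))

/-- A quadratic minorant of `f` around an interior point in terms of its modulus of smoothness. -/
theorem exists_quadratic_minorant {f : ℝ → ℝ} (hf : ContinuousOn f I01)
    {p lam M h x V W : ℝ} (hp0 : 0 < p) (hp : p ≤ 1 / 2) (hlam0 : 0 ≤ lam)
    (hlam : lam ≤ 2 - p) (hM : 0 < M) (hh : 0 < h) (hx : x ∈ Set.Ioo (0 : ℝ) 1) (hV : 0 ≤ V)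
    (h0 : M ≤ x ∨ M ^ 2 ≤ V) (h1 : M ≤ 1 - x ∨ M ^ 2 ≤ V)
    (hW : omega2 (fun y => phi y ^ lam) f h < W) :
    ∃ a b c : ℝ, b * V + c ≤ W * (1 + 3 * (4 / (p ^ 2 * h ^ 2 * M ^ lam) * V)) ∧
      ∀ t ∈ I01, f x + a * (t - x) - b * (t - x) ^ 2 - c ≤ f t := by
  have hW0 : 0 < W := (omega2_nonneg _ _ _).trans_lt hW
  have hMl := Real.rpow_pos_of_pos hM lam
  set N := 4 / (p ^ 2 * h ^ 2 * M ^ lam) with hN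
  have hN0 : 0 < N := by positivity
  have hN1 : N * (p ^ 2 / 4 * h ^ 2 * M ^ lam) = 1 := by
    rw [hN]
    field_simp
  set P := barrier p (M ^ (2 - p)) with hP
  have hd : ∀ m ∈ Set.Ioo (0 : ℝ) 1, 0 < h * phi m ^ lam := fun m hm =>
    mul_pos hh (Real.rpow_pos_of_pos (phi_pos hm) _)
  have hI : ∀ {m : ℝ}, m ∈ Set.Ioo (0 : ℝ) 1 → m ∈ I01 := fun hm => ⟨hm.1.le, hm.2.le⟩
  have hmod : ∀ m ∈ Set.Ioo (0 : ℝ) 1, ∀ δ, 0 < δ → δ ≤ h * phi m ^ lam → 0 ≤ m - δ →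
      m + δ ≤ 1 → -W < f (m - δ) - 2 * f m + f (m + δ) := by
    intro m hm δ hδ hδd a b
    have hφ : 0 < phi m ^ lam := Real.rpow_pos_of_pos (phi_pos hm) _
    have e : δ / phi m ^ lam * phi m ^ lam = δ := div_mul_cancel₀ _ hφ.ne'
    have := abs_second_difference_le_omega2 (ψ := fun y => phi y ^ lam) hf
      (div_pos hδ hφ) ((div_le_iff₀ hφ).2 hδd) (hI hm)
      (by rw [e]; exact ⟨a, by linarith [hm.2]⟩) (by rw [e]; exact ⟨by linarith [hm.1], b⟩)
    rw [e] at this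
    linarith [neg_le_of_abs_le this]
  obtain ⟨a, ha⟩ := exists_support_line (F := fun t => f t + W * N * P t)
    (d := fun m => h * phi m ^ lam) hW0.le
    (hf.add (continuousOn_const.mul (continuous_barrier hp0 _).continuousOn)) hd
    (fun m hm u v => by
      have e1 := hmod m hm _ (hd m hm) le_rfl u v
      have e2 := mul_le_mul_of_nonneg_left
        (barrier_second_difference_phi hp0 hp hlam0 hlam hM hh hm.1 hm.2 u v)
        (mul_pos hW0 hN0).le
      rw [mul_assoc W N (_ * _), hN1] at e2
      linarith)
    (fun m hm δ hδ hδd u v => by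
      have e1 := hmod m hm δ hδ hδd u v
      have hw : 0 < m * (1 - m) := mul_pos hm.1 (sub_pos.2 hm.2)
      have e2 := barrier_second_difference hp0 hp (Real.rpow_nonneg hM.le (2 - p)) hδ.le
        hm.1 hm.2 u v
      have e3 := mul_le_mul_of_nonneg_left (le_trans (by positivity) e2)
        (mul_pos hW0 hN0).le
      linarith) hx
  obtain ⟨a', b, c, hbc, hq⟩ := barrier_quadratic_upper hp0 (by linarith) hM hx.1 hx.2 hV h0 h1
  refine ⟨a - W * N * a', W * N * b, W + W * N * c, ?_, fun t ht => ?_⟩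
  · have := mul_le_mul_of_nonneg_left hbc (mul_pos hW0 hN0).le
    linarith
  · have e1 := ha t ht
    have e2 := mul_le_mul_of_nonneg_left (hq t ht) (mul_pos hW0 hN0).le
    linarith

/-- A positive operator respects quadratic minorants. -/
theorem PositiveLinearOp.le_of_quadratic_minorant {L : (ℝ → ℝ) → (ℝ → ℝ)}
    (hL : PositiveLinearOp L) {x V : ℝ} (hx : x ∈ I01) (h1 : L (fun _ => 1) x = 1)
    (he1 : L (fun y => y) x = x) (he2 : L (fun y => y ^ 2) x - x ^ 2 = V)
    {f : ℝ → ℝ} (hf : ContinuousOn f I01) {k a b c : ℝ}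
    (hq : ∀ t ∈ I01, k + a * (t - x) - b * (t - x) ^ 2 - c ≤ f t) :
    k - (b * V + c) ≤ L f x := by
  obtain ⟨hadd, hmul, -, hpos⟩ := hL
  have c1 : ContinuousOn (fun _ : ℝ => (1 : ℝ)) I01 := continuousOn_const
  have c2 : ContinuousOn (fun y : ℝ => y) I01 := continuousOn_id
  have c3 : ContinuousOn (fun y : ℝ => y ^ 2) I01 := by fun_prop
  have m1 := hmul (-k + a * x + b * x ^ 2 + c) _ c1 x hx
  have m2 := hmul (-a - 2 * b * x) _ c2 x hx
  have m3 := hmul b _ c3 x hx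
  have d1 : ContinuousOn (fun y : ℝ => (-k + a * x + b * x ^ 2 + c) * (1 : ℝ)) I01 := by fun_prop
  have d2 : ContinuousOn (fun y : ℝ => (-a - 2 * b * x) * y) I01 := by fun_prop
  have d3 : ContinuousOn (fun y : ℝ => b * y ^ 2) I01 := by fun_prop
  have a1 := hadd _ _ hf d1 x hx
  have a2 := hadd _ _ (hf.add d1) d2 x hx
  have a3 := hadd _ _ ((hf.add d1).add d2) d3 x hx
  have hp := hpos _ (((hf.add d1).add d2).add d3)
    (fun t ht => by
      have := hq t ht
      simp only [Pi.add_apply]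
      nlinarith) x hx
  simp only [Pi.add_def] at a1 a2 a3 hp
  rw [a3, a2, a1, m1, m2, m3, h1, he1] at hp
  have : L (fun y => y ^ 2) x = V + x ^ 2 := by linarith
  rw [this] at hp
  nlinarith

theorem statement5 :
    ∃ c₀ : ℝ, 0 < c₀ ∧ ∃ c : ℝ → ℝ,
      (∀ lam ∈ Set.Ico (0 : ℝ) 2, 0 < c lam) ∧
      ∀ (n : ℕ) (L : (ℝ → ℝ) → (ℝ → ℝ)) (α : ℝ),
        PositiveLinearOp L →
        (∀ f, ContinuousOn f I01 → IsPolyOfDegLe n (L f)) →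
        (∀ x ∈ I01, L (fun _ => 1) x = 1) →
        (∀ x ∈ I01, L (fun y => y) x = x) →
        0 < α →
        (∀ x ∈ I01, L (fun y => y ^ 2) x - x ^ 2 = α * phi x ^ 2) →
        ∀ lam ∈ Set.Ico (0 : ℝ) 2, ∀ f, ContinuousOn f I01 → ∀ x ∈ I01,
          ∀ h : ℝ, 0 < h → h ≤ c₀ →
            |f x - L f x| ≤
              c lam * (1 + α * phi x ^ ((2 : ℝ) - lam) /
                  (h ^ 2 * (phi x + Real.sqrt (min α (1 / 4))) ^ lam)) *
                omega2 (fun y => phi y ^ lam) f h := by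
  refine ⟨1, one_pos, fun lam => 1 + 12 * 2 ^ lam / ((2 - lam) / 4) ^ 2,
    fun lam hlam => by positivity, ?_⟩
  intro n L α hL _ h1 he1 hα he2 lam hlam f hf x hx h hh _
  set p := (2 - lam) / 4 with hp
  have hlam0 : 0 ≤ lam := hlam.1
  have hlam2 : lam < 2 := hlam.2
  have hp0 : 0 < p := by rw [hp]; linarith
  set s := Real.sqrt (min α (1 / 4)) with hs
  have hs0 : 0 < s := Real.sqrt_pos.2 (lt_min hα (by norm_num))
  have hsα : s ^ 2 ≤ α := by
    rw [hs, Real.sq_sqrt (le_min hα.le (by norm_num))]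
    exact min_le_left _ _
  have hphi : Continuous phi := by unfold phi; fun_prop
  have hphi0 : ∀ y, 0 ≤ phi y := fun y => Real.sqrt_nonneg _
  have hsum : ∀ y, 0 < phi y + s := fun y => add_pos_of_nonneg_of_pos (hphi0 y) hs0
  set w := omega2 (fun y => phi y ^ lam) f h with hw
  have hw0 : 0 ≤ w := omega2_nonneg _ _ _
  have main : ∀ y ∈ Set.Ioo (0 : ℝ) 1, |f y - L f y| ≤
      (1 + 12 * 2 ^ lam / p ^ 2) * (1 + α * phi y ^ ((2 : ℝ) - lam) /
        (h ^ 2 * (phi y + s) ^ lam)) * w := by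
    intro y hy
    have hyI : y ∈ I01 := ⟨hy.1.le, hy.2.le⟩
    have hφ := phi_pos hy
    have hφ2 : phi y ^ 2 = y * (1 - y) :=
      Real.sq_sqrt (mul_pos hy.1 (sub_pos.2 hy.2)).le
    set M := phi y * (phi y + s) / 2 with hM
    have hM0 : 0 < M := by
      have := hsum y
      positivity
    have hV : 0 ≤ α * phi y ^ 2 := by positivity
    have hcase : M ≤ phi y ^ 2 ∨ M ^ 2 ≤ α * phi y ^ 2 := by
      rcases le_total s (phi y) with hle | hle
      · left
        nlinarith
      · right
        have : M ≤ phi y * s := by nlinarith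
        calc M ^ 2 ≤ (phi y * s) ^ 2 := pow_le_pow_left₀ hM0.le this 2
          _ = s ^ 2 * phi y ^ 2 := by ring
          _ ≤ α * phi y ^ 2 := mul_le_mul_of_nonneg_right hsα (sq_nonneg _)
    have hc0 : M ≤ y ∨ M ^ 2 ≤ α * phi y ^ 2 :=
      hcase.imp_left fun h => h.trans (by nlinarith [hy.1, hy.2])
    have hc1 : M ≤ 1 - y ∨ M ^ 2 ≤ α * phi y ^ 2 :=
      hcase.imp_left fun h => h.trans (by nlinarith [hy.1, hy.2])
    set X := α * phi y ^ ((2 : ℝ) - lam) / (h ^ 2 * (phi y + s) ^ lam) with hX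
    have hX0 : 0 ≤ X := by
      have := Real.rpow_pos_of_pos (hsum y) lam
      have := Real.rpow_pos_of_pos hφ (2 - lam)
      positivity
    have hNX : 4 / (p ^ 2 * h ^ 2 * M ^ lam) * (α * phi y ^ 2) = 4 * 2 ^ lam / p ^ 2 * X := by
      have b1 := Real.rpow_pos_of_pos (hsum y) lam
      have b2 := Real.rpow_pos_of_pos hφ lam
      have b3 := Real.rpow_pos_of_pos (two_pos : (0 : ℝ) < 2) lam
      rw [hX, hM, Real.div_rpow (mul_pos hφ (hsum y)).le two_pos.le,
        Real.mul_rpow hφ.le (hsum y).le, Real.rpow_sub hφ, Real.rpow_two]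
      field_simp
    have lower : ∀ g : ℝ → ℝ, ContinuousOn g I01 → ∀ W,
        omega2 (fun y => phi y ^ lam) g h < W →
        g y - W * (1 + 12 * 2 ^ lam / p ^ 2 * X) ≤ L g y := by
      intro g hg W hW
      obtain ⟨a, b, c, hbc, hq⟩ := exists_quadratic_minorant hg hp0 (by linarith) hlam0
        (by linarith) hM0 hh hy hV hc0 hc1 hW
      have := hL.le_of_quadratic_minorant hyI (h1 y hyI) (he1 y hyI) (he2 y hyI) hg hq
      rw [hNX] at hbc
      have e : 3 * (4 * 2 ^ lam / p ^ 2 * X) = 12 * 2 ^ lam / p ^ 2 * X := by ring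
      rw [e] at hbc
      linarith
    have hk : 0 < 12 * (2 : ℝ) ^ lam / p ^ 2 := by positivity
    set B := 1 + 12 * 2 ^ lam / p ^ 2 * X with hB
    have hB0 : 0 < B := by positivity
    have hneg : L (fun t => -f t) y = -L f y := by
      simpa using hL.2.1 (-1) f hf y hyI
    have upper : |f y - L f y| ≤ B * w := by
      refine le_of_forall_pos_le_add fun ε hε => ?_
      have hlt : w < w + ε / B := by linarith [div_pos hε hB0]
      have e1 := lower f hf _ hlt
      have e2 := lower (fun t => -f t) hf.neg (w + ε / B) (by rw [omega2_neg]; exact hlt)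
      have e3 : (w + ε / B) * B = B * w + ε := by field_simp
      rw [e3] at e1 e2
      rw [hneg] at e2
      rw [abs_le]
      constructor <;> linarith
    refine upper.trans (mul_le_mul_of_nonneg_right ?_ hw0)
    nlinarith
  have hcl : closure (Set.Ioo (0 : ℝ) 1) = I01 := closure_Ioo zero_ne_one
  refine le_on_closure main ?_ ?_ (hcl ▸ hx)
  · rw [hcl]
    exact (hf.sub (hL.2.2.1 f hf)).abs
  · refine Continuous.continuousOn ?_
    have r1 : Continuous fun y => phi y ^ ((2 : ℝ) - lam) :=
      hphi.rpow_const fun _ => Or.inr (by linarith)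
    have r2 : Continuous fun y => (phi y + s) ^ lam :=
      (hphi.add continuous_const).rpow_const fun _ => Or.inr hlam0
    refine (continuous_const.mul (continuous_const.add ?_)).mul continuous_const
    refine (continuous_const.mul r1).div (continuous_const.mul r2) fun y => ?_
    exact (mul_pos (pow_pos hh 2) (Real.rpow_pos_of_pos (hsum y) lam)).ne'
end
end
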